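/- arXiv:1401.7722 — 2 statements merged into one kernel-verified Lean document; each statement's English description precedes it below -/
import Mathlib

section
/- Assume mu_l ≤ mu_h and F(y_0) > 0. Then for every fixed integer i ≥ 1, lim_{j→∞} pi_{i,j}/eta_1^j = C_{i,1}, where C_{i,1} = ((1 − (p·mu_h+(1−p)(1−mu_l))·(q/eta_1+1−q) − (1−p)·mu_l·(q+(1−q)·eta_1))/((1−p)·mu_h·(q/eta_1+1−q)))·(p(1−mu_h)/((1−p)·mu_h − (1−p)·mu_l·(1−eta_1)))^{i−1}·C_{l,1}, and C_{l,1} = 2·a·F(1/eta_1)/(q/eta_1 + 1−q) with a = (pi_{0,0}/(2(1−p)·mu_l))·eta_1/(eta_1−eta_2). -/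
/-- The balance equations of the discrete-time preemptive priority queue
(early arrival system). -/
def BalanceEquations (p q mh ml : ℝ) (pi : ℕ → ℕ → ℝ) : Prop :=
  ((1 - ((1-p)*(1-q) + p*(1-q)*mh + (1-p)*q*ml)) * pi 0 0 =
      (1-p)*(1-q)*mh * pi 1 0 + (1-p)*(1-q)*ml * pi 0 1) ∧
  (∀ i : ℕ, 1 ≤ i →
    (1 - ((1-p)*(1-q)*(1-mh) + p*(1-q)*mh)) * pi i 0 =
      p*(1-q)*(1-mh) * pi (i-1) 0 + (1-p)*(1-q)*mh * pi (i+1) 0) ∧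
  (∀ j : ℕ, 1 ≤ j →
    (1 - ((1-p)*(1-q)*(1-ml) + p*(1-q)*mh + (1-p)*q*ml)) * pi 0 j =
      (p*q*mh + (1-p)*q*(1-ml)) * pi 0 (j-1) + (1-p)*(1-q)*ml * pi 0 (j+1) +
      (1-p)*q*mh * pi 1 (j-1) + (1-p)*(1-q)*mh * pi 1 j) ∧
  (∀ i j : ℕ, 1 ≤ i → 1 ≤ j →
    (1 - ((1-p)*(1-q)*(1-mh) + p*(1-q)*mh)) * pi i j =
      p*(1-q)*(1-mh) * pi (i-1) j + (1-p)*(1-q)*mh * pi (i+1) j +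
      (1-p)*q*mh * pi (i+1) (j-1) + (p*q*mh + (1-p)*q*(1-mh)) * pi i (j-1) +
      p*q*(1-mh) * pi (i-1) (j-1))

open PowerSeries in
/-- `PowerSeries.EvaluatesTo f y v`: the series `f` converges absolutely at `y`, with sum `v`. -/
def PowerSeries.EvaluatesTo (f : ℝ⟦X⟧) (y v : ℝ) : Prop :=
  (Summable fun n => ‖coeff n f * y ^ n‖) ∧ HasSum (fun n => coeff n f * y ^ n) v

namespace PowerSeries.EvaluatesTo

open PowerSeries

variable {f g : ℝ⟦X⟧} {y v w : ℝ}

theorem add (hf : f.EvaluatesTo y v) (hg : g.EvaluatesTo y w) :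
    (f + g).EvaluatesTo y (v + w) := by
  refine ⟨?_, ?_⟩
  · refine Summable.of_nonneg_of_le (fun _ => norm_nonneg _) (fun n => ?_) (hf.1.add hg.1)
    rw [map_add, add_mul]
    exact norm_add_le _ _
  · simpa only [map_add, add_mul] using hf.2.add hg.2

theorem mul (hf : f.EvaluatesTo y v) (hg : g.EvaluatesTo y w) :
    (f * g).EvaluatesTo y (v * w) := by
  have key : ∀ n, coeff n (f * g) * y ^ n =
      ∑ kl ∈ Finset.HasAntidiagonal.antidiagonal n,
        (coeff kl.1 f * y ^ kl.1) * (coeff kl.2 g * y ^ kl.2) := by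
    intro n
    rw [coeff_mul, Finset.sum_mul]
    refine Finset.sum_congr rfl fun kl hkl => ?_
    rw [← Finset.HasAntidiagonal.mem_antidiagonal.1 hkl, pow_add]
    ring
  have hs := summable_norm_sum_mul_antidiagonal_of_summable_norm hf.1 hg.1
  simp only [← key] at hs
  refine ⟨hs, ?_⟩
  have ht := tsum_mul_tsum_eq_tsum_sum_antidiagonal_of_summable_norm hf.1 hg.1
  simp only [← key] at ht
  rw [hf.2.tsum_eq, hg.2.tsum_eq] at ht
  rw [ht]
  exact hs.of_norm.hasSum

theorem const (a y : ℝ) : (C a : ℝ⟦X⟧).EvaluatesTo y a := by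
  have h : ∀ n, n ≠ 0 → coeff n (C a : ℝ⟦X⟧) * y ^ n = 0 := fun n hn => by
    simp [coeff_C, hn]
  refine ⟨summable_of_ne_finset_zero (s := {0}) fun n hn => ?_, ?_⟩
  · rw [h n (by simpa using hn), norm_zero]
  · simpa using hasSum_single 0 h

theorem X (y : ℝ) : (X : ℝ⟦X⟧).EvaluatesTo y y := by
  have h : ∀ n, n ≠ 1 → coeff n (PowerSeries.X : ℝ⟦X⟧) * y ^ n = 0 := fun n hn => by
    simp [coeff_X, hn]
  refine ⟨summable_of_ne_finset_zero (s := {1}) fun n hn => ?_, ?_⟩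
  · rw [h n (by simpa using hn), norm_zero]
  · simpa using hasSum_single 1 h

theorem unique (hf : f.EvaluatesTo y v) (hf' : f.EvaluatesTo y w) : v = w :=
  hf.2.unique hf'.2

end PowerSeries.EvaluatesTo

section KernelRoot

open PowerSeries

/-- The coefficients of the power series `r` solving
`r = (1 - q + q X) (A r ^ 2 + e r + c)` with constant coefficient `r0`, where
`s = 1 - (1 - q) e - 2 (1 - q) A r0`. -/
noncomputable def rootCoeff (A e c q s r0 : ℝ) : ℕ → ℝ
  | 0 => r0
  | n + 1 =>
    ((1 - q) * A * ∑ k : Fin n,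
        rootCoeff A e c q s r0 (k + 1) * rootCoeff A e c q s r0 (n - k) +
      q * (A * ∑ k : Fin (n + 1), rootCoeff A e c q s r0 k * rootCoeff A e c q s r0 (n - k) +
        e * rootCoeff A e c q s r0 n + if n = 0 then c else 0)) / s
  decreasing_by all_goals omega

theorem exists_kernel_root_series {A e c q : ℝ} (hA : 0 < A) (he : 0 < e) (hc : 0 < c)
    (hq : 0 < q) (hq1 : q < 1) (hsum : A + e + c = 1) :
    ∃ r : ℝ⟦X⟧, (∀ n, 0 ≤ coeff n r) ∧
      r = (C (1 - q) + C q * X) * (C A * r ^ 2 + C e * r + C c) ∧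
      0 < coeff 0 r ∧ A * coeff 0 r < c ∧ 0 < 1 - (1 - q) * e - 2 * (1 - q) * A * coeff 0 r := by
  have hcont : Continuous fun x : ℝ => x - (1 - q) * (A * x ^ 2 + e * x + c) := by fun_prop
  obtain ⟨r0, ⟨h0, h1⟩, hr0⟩ := intermediate_value_Ioo (zero_le_one' ℝ) hcont.continuousOn
    (show (0 : ℝ) ∈ Set.Ioo _ _ from ⟨by nlinarith, by nlinarith⟩)
  simp only at hr0
  obtain ⟨s, hs⟩ : ∃ s, s = 1 - (1 - q) * e - 2 * (1 - q) * A * r0 := ⟨_, rfl⟩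
  have hqA : 0 < (1 - q) * A := mul_pos (by linarith) hA
  have hs' : (1 - q) * A * (1 - r0) < s := by
    have : 0 < (1 - r0) * (s - (1 - q) * A * (1 - r0)) := by
      have : (1 - r0) * (s - (1 - q) * A * (1 - r0)) = q := by
        subst hs
        linear_combination (q - 1) * hsum - hr0
      rw [this]; exact hq
    have := (mul_pos_iff_of_pos_left (by linarith)).1 this
    linarith
  have hspos : 0 < s := lt_trans (mul_pos hqA (by linarith)) hs'
  set u := rootCoeff A e c q s r0 with hu
  have u0 : u 0 = r0 := by rw [hu, rootCoeff]
  have usucc : ∀ n, u (n + 1) = ((1 - q) * A * ∑ k ∈ Finset.range n, u (k + 1) * u (n - k) +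
      q * (A * ∑ k ∈ Finset.range (n + 1), u k * u (n - k) + e * u n +
        if n = 0 then c else 0)) / s := by
    intro n
    rw [hu, rootCoeff, ← Fin.sum_univ_eq_sum_range (fun k => _ * _),
      ← Fin.sum_univ_eq_sum_range (fun k => _ * _)]
  have unn : ∀ n, 0 ≤ u n := by
    intro n
    induction n using Nat.strong_induction_on with
    | _ n ih =>
      cases n with
      | zero => rw [u0]; exact h0.le
      | succ n =>
        rw [usucc]
        refine div_nonneg (add_nonneg (mul_nonneg hqA.le (Finset.sum_nonneg fun k hk => ?_))
          (mul_nonneg hq.le (add_nonneg (add_nonneg (mul_nonneg hA.le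
            (Finset.sum_nonneg fun k hk => ?_)) (mul_nonneg he.le (ih n (by omega)))) ?_))) hspos.le
        · have := Finset.mem_range.1 hk
          exact mul_nonneg (ih _ (by omega)) (ih _ (by omega))
        · have := Finset.mem_range.1 hk
          exact mul_nonneg (ih _ (by omega)) (ih _ (by omega))
        · split_ifs
          exacts [hc.le, le_rfl]
  have hsq : ∀ n, coeff n ((mk u) ^ 2) = ∑ k ∈ Finset.range (n + 1), u k * u (n - k) := by
    intro n
    rw [pow_two, coeff_mul, Finset.Nat.sum_antidiagonal_eq_sum_range_succ_mk]
    simp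
  refine ⟨mk u, fun n => by simpa using unn n, ?_, by simpa [u0] using h0, ?_, ?_⟩
  · ext n
    cases n with
    | zero =>
      rw [add_mul, map_add, coeff_C_mul, mul_assoc, coeff_C_mul, coeff_zero_X_mul, map_add,
        map_add, coeff_C_mul, coeff_C_mul, hsq, coeff_mk]
      simp [u0]
      linear_combination hr0
    | succ n =>
      rw [add_mul, map_add, coeff_C_mul, mul_assoc, coeff_C_mul, coeff_succ_X_mul, map_add,
        map_add, map_add, map_add, coeff_C_mul, coeff_C_mul, coeff_C_mul, coeff_C_mul, hsq, hsq,
        coeff_C, coeff_C, coeff_mk, coeff_mk, Finset.sum_range_succ _ (n + 1),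
        Finset.sum_range_succ' _ n]
      have h := usucc n
      rw [eq_div_iff hspos.ne', hs] at h
      simp only [Nat.add_sub_add_right, Nat.sub_zero, Nat.sub_self, u0,
        if_neg (Nat.succ_ne_zero n)]
      linear_combination h
  · simp only [coeff_mk, u0]
    have h : (1 - q) * (c - A * r0) = r0 * (s - (1 - q) * A * (1 - r0)) := by
      subst hs
      linear_combination -hr0
    have := (mul_pos_iff_of_pos_left (by linarith : 0 < 1 - q)).1
      (h ▸ mul_pos h0 (by linarith))
    linarith
  · simpa only [coeff_mk, u0, hs] using hspos

/-- A nonnegative solution of the kernel equation stays below a barrier `m` at every point of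
an interval on which the right-hand side sends `m` strictly below itself. -/
theorem kernel_root_partial_sum_lt {A e c q m y : ℝ} (hA : 0 < A) (he : 0 < e) (hc : 0 < c)
    (hq : 0 < q) (hq1 : q < 1) {r : ℝ⟦X⟧} (hr : ∀ n, 0 ≤ coeff n r)
    (heq : r = (C (1 - q) + C q * X) * (C A * r ^ 2 + C e * r + C c))
    (hr0 : coeff 0 r < m) (hm0 : 0 < m) (hy : 0 ≤ y)
    (hm : ∀ z, 0 ≤ z → z ≤ y → (1 - q + q * z) * (A * m ^ 2 + e * m + c) < m) (n : ℕ) :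
    ∑ k ∈ Finset.range n, coeff k r * y ^ k < m := by
  have mul_le : ∀ (f g : ℝ⟦X⟧) (z : ℝ), 0 ≤ z → (∀ k, 0 ≤ coeff k f) → (∀ k, 0 ≤ coeff k g) →
      ∑ k ∈ Finset.range n, coeff k (f * g) * z ^ k ≤
        (∑ k ∈ Finset.range n, coeff k f * z ^ k) * ∑ k ∈ Finset.range n, coeff k g * z ^ k := by
    intro f g z hz hf hg
    have h1 : ∀ k, coeff k (f * g) * z ^ k = ∑ i ∈ Finset.range (k + 1),
        (coeff i f * z ^ i) * (coeff (k - i) g * z ^ (k - i)) := by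
      intro k
      rw [coeff_mul, Finset.Nat.sum_antidiagonal_eq_sum_range_succ_mk, Finset.sum_mul]
      refine Finset.sum_congr rfl fun i hi => ?_
      have : z ^ k = z ^ i * z ^ (k - i) := by
        rw [← pow_add, Nat.add_sub_cancel' (Nat.lt_succ_iff.1 (Finset.mem_range.1 hi))]
      rw [this]
      ring
    simp only [h1]
    rw [Finset.sum_range_diag_flip n fun i j => (coeff i f * z ^ i) * (coeff j g * z ^ j),
      Finset.sum_mul_sum]
    refine Finset.sum_le_sum fun i _ => Finset.sum_le_sum_of_subset_of_nonneg
      (Finset.range_subset_range.2 (Nat.sub_le _ _)) fun j _ _ => ?_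
    exact mul_nonneg (mul_nonneg (hf _) (pow_nonneg hz _)) (mul_nonneg (hg _) (pow_nonneg hz _))
  have const_le : ∀ (a z : ℝ), 0 ≤ a → ∑ k ∈ Finset.range n, coeff k (C a : ℝ⟦X⟧) * z ^ k ≤ a := by
    intro a z ha
    cases n with
    | zero => simpa using ha
    | succ n => simp [coeff_C]
  have step : ∀ z, 0 ≤ z → ∑ k ∈ Finset.range n, coeff k r * z ^ k ≤
      (1 - q + q * z) * (A * (∑ k ∈ Finset.range n, coeff k r * z ^ k) ^ 2 +
        e * (∑ k ∈ Finset.range n, coeff k r * z ^ k) + c) := by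
    intro z hz
    set S := ∑ k ∈ Finset.range n, coeff k r * z ^ k with hS
    have hS0 : 0 ≤ S := Finset.sum_nonneg fun k _ => mul_nonneg (hr k) (pow_nonneg hz k)
    have hlin : ∀ k, 0 ≤ coeff k (C (1 - q) + C q * X : ℝ⟦X⟧) := by
      intro k
      rw [map_add, coeff_C_mul, coeff_C, coeff_X]
      split_ifs <;> simp <;> linarith
    have hsq : ∀ k, 0 ≤ coeff k (r ^ 2) := by
      intro k
      rw [pow_two, coeff_mul]
      exact Finset.sum_nonneg fun i _ => mul_nonneg (hr _) (hr _)
    have hquad : ∀ k, 0 ≤ coeff k (C A * r ^ 2 + C e * r + C c) := by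
      intro k
      rw [map_add, map_add, coeff_C_mul, coeff_C_mul, coeff_C]
      refine add_nonneg (add_nonneg (mul_nonneg hA.le (hsq k)) (mul_nonneg he.le (hr k))) ?_
      split_ifs
      exacts [hc.le, le_rfl]
    have h1 : S ≤ _ := (congrArg (fun f => ∑ k ∈ Finset.range n, coeff k f * z ^ k) heq).le.trans
      (mul_le _ _ z hz hlin hquad)
    refine h1.trans (mul_le_mul ?_ ?_ (Finset.sum_nonneg fun k _ =>
      mul_nonneg (hquad k) (pow_nonneg hz k)) (by nlinarith))
    · rcases n with _ | _ | n
      · simp; nlinarith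
      · simp; nlinarith
      · simp only [map_add, add_mul, Finset.sum_add_distrib]
        refine add_le_add (const_le _ z (by linarith)) ?_
        rw [Finset.sum_range_succ', Finset.sum_range_succ']
        simp [coeff_X]
    · simp only [map_add, add_mul, Finset.sum_add_distrib, coeff_C_mul, mul_assoc,
        ← Finset.mul_sum]
      rw [← hS]
      refine add_le_add (add_le_add (mul_le_mul_of_nonneg_left ?_ hA.le) le_rfl)
        (const_le _ z hc.le)
      rw [pow_two, pow_two]
      exact mul_le r r z hz hr hr
  by_contra! hge
  have hcont : ContinuousOn (fun z : ℝ => ∑ k ∈ Finset.range n, coeff k r * z ^ k)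
      (Set.Icc 0 y) := by fun_prop
  have hzero : ∑ k ∈ Finset.range n, coeff k r * (0 : ℝ) ^ k ≤ m := by
    cases n with
    | zero => simpa using hm0.le
    | succ n => rw [Finset.sum_range_succ']; simpa using hr0.le
  obtain ⟨z, ⟨hz0, hzy⟩, hz⟩ := intermediate_value_Icc hy hcont ⟨hzero, hge⟩
  have := step z hz0
  simp only at hz
  rw [hz] at this
  exact absurd (hm z hz0 hzy) (not_lt.2 this)

end KernelRoot

section Sequences

open Filter Topology PowerSeries

theorem tendsto_sum_range_mul_of_summable {a x : ℕ → ℝ} {s l : ℝ}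
    (ha : Summable fun n => ‖a n‖) (hs : HasSum a s) (hx : Tendsto x atTop (𝓝 l)) :
    Tendsto (fun n => ∑ k ∈ Finset.range (n + 1), a k * x (n - k)) atTop (𝓝 (s * l)) := by
  obtain ⟨B, hB⟩ := hx.norm.bddAbove_range
  have hB' : ∀ n, ‖x n‖ ≤ B := fun n => hB ⟨n, rfl⟩
  have hterm : ∀ k, Tendsto (fun n => if k < n + 1 then a k * x (n - k) else 0) atTop
      (𝓝 (a k * l)) := by
    intro k
    refine ((hx.comp (tendsto_sub_atTop_nat k)).const_mul (a k)).congr' ?_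
    filter_upwards [eventually_ge_atTop k] with n hn
    rw [if_pos (by omega)]
    rfl
  have h := tendsto_tsum_of_dominated_convergence (𝓕 := atTop) (ha.mul_right B) hterm
    (Eventually.of_forall fun n k => by
      split_ifs
      · rw [norm_mul]
        exact mul_le_mul_of_nonneg_left (hB' _) (norm_nonneg _)
      · rw [norm_zero]
        exact mul_nonneg (norm_nonneg _) ((norm_nonneg _).trans (hB' 0)))
  rw [tsum_mul_right, hs.tsum_eq] at h
  refine h.congr fun n => ?_
  rw [tsum_eq_sum (s := Finset.range (n + 1)) fun k hk => if_neg (by simpa using hk)]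
  exact Finset.sum_congr rfl fun k hk => if_pos (Finset.mem_range.1 hk)

theorem tendsto_of_tendsto_succ_add_mul {x : ℕ → ℝ} {t L : ℝ} (hx : ∀ n, 0 ≤ x n) (ht : 0 < t)
    (h : Tendsto (fun n => x (n + 1) + t * x n) atTop (𝓝 L))
    (h1 : t = 1 → Tendsto (fun n => x (n + 1) - x n) atTop (𝓝 0)) :
    Tendsto x atTop (𝓝 (L / (1 + t))) := by
  rcases lt_trichotomy t 1 with hlt | rfl | hgt
  · set l : ℕ → ℝ := fun n => Nat.casesOn n (x 0) fun n => x (n + 1) + t * x n with hl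
    have hlL : Tendsto l atTop (𝓝 L) := (tendsto_add_atTop_iff_nat 1).1 h
    have hnorm : ‖-t‖ < 1 := by rwa [norm_neg, Real.norm_of_nonneg ht.le]
    have hc := tendsto_sum_range_mul_of_summable (summable_norm_geometric_of_norm_lt_one hnorm)
      (hasSum_geometric_of_norm_lt_one hnorm) hlL
    rw [show (1 - -t)⁻¹ * L = L / (1 + t) by rw [sub_neg_eq_add, div_eq_inv_mul]] at hc
    refine hc.congr fun n => ?_
    induction n with
    | zero => simp [hl]
    | succ n ih =>
      rw [Finset.sum_range_succ']
      have : ∀ k ∈ Finset.range (n + 1), (-t) ^ (k + 1) * l (n + 1 - (k + 1)) =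
          (-t) * ((-t) ^ k * l (n - k)) := by
        intro k _
        rw [Nat.add_sub_add_right, pow_succ]
        ring
      rw [Finset.sum_congr rfl this, ← Finset.mul_sum, ih]
      simp only [hl, pow_zero, Nat.sub_zero]
      ring
  · have h2 := (h.sub (h1 rfl)).const_mul (1 / 2)
    rw [show 1 / 2 * (L - 0) = L / (1 + 1) by ring] at h2
    exact h2.congr fun n => by ring
  · obtain ⟨M, hM⟩ := h.bddAbove_range
    set l := L / (1 + t) with hl
    have hlt : l + t * l = L := by rw [hl]; field_simp
    have hxM : ∀ n, |x n - l| ≤ M + |l| := by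
      intro n
      have h1 : x (n + 1) + t * x n ≤ M := hM ⟨n, rfl⟩
      have h2 : x n ≤ M := by nlinarith [hx n, hx (n + 1)]
      calc |x n - l| ≤ |x n| + |l| := abs_sub _ _
        _ ≤ M + |l| := by rw [abs_of_nonneg (hx n)]; linarith
    rw [Metric.tendsto_atTop] at h ⊢
    intro ε hε
    obtain ⟨N, hN⟩ := h ((t - 1) * (ε / 2)) (mul_pos (by linarith) (by linarith))
    refine ⟨N, fun n hn => ?_⟩
    have key : ∀ m n, N ≤ n → |x n - l| ≤ ε / 2 + (M + |l|) * t⁻¹ ^ m := by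
      intro m
      induction m with
      | zero =>
        intro n _
        have := hxM n
        rw [pow_zero]
        linarith
      | succ m ih =>
        intro n hn
        have h1 := ih (n + 1) (by omega)
        have h2 := (hN n hn).le
        rw [Real.dist_eq] at h2
        have h3 : t * |x n - l| ≤
            (t - 1) * (ε / 2) + (ε / 2 + (M + |l|) * t⁻¹ ^ m) := by
          have : t * |x n - l| = |(x (n + 1) + t * x n - L) - (x (n + 1) - l)| := by
            rw [← abs_of_pos ht, ← abs_mul, abs_of_pos ht, ← hlt]
            congr 1
            ring
          rw [this]
          exact (abs_sub _ _).trans (add_le_add h2 h1)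
        have h4 : |x n - l| ≤ t⁻¹ * ((t - 1) * (ε / 2) + (ε / 2 + (M + |l|) * t⁻¹ ^ m)) := by
          rw [inv_mul_eq_div, le_div_iff₀ ht, mul_comm]
          exact h3
        refine h4.trans (le_of_eq ?_)
        rw [pow_succ]
        field_simp
        ring
    have hlim : Tendsto (fun m => ε / 2 + (M + |l|) * t⁻¹ ^ m) atTop
        (𝓝 (ε / 2 + (M + |l|) * 0)) :=
      ((tendsto_pow_atTop_nhds_zero_of_lt_one (inv_nonneg.2 ht.le)
        (inv_lt_one_of_one_lt₀ hgt)).const_mul _).const_add _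
    have := ge_of_tendsto' hlim fun m => key m n hn
    rw [Real.dist_eq]
    linarith

theorem tendsto_coeff_mul_inv_pow {W G : ℝ⟦X⟧} {t v : ℝ} (ht : t ≠ 0)
    (h : W * (1 - C t * X) = G) (hG : G.EvaluatesTo t⁻¹ v) :
    Tendsto (fun n => coeff n W * t⁻¹ ^ n) atTop (𝓝 v) := by
  refine ((tendsto_add_atTop_iff_nat 1).2 hG.2.tendsto_sum_nat).congr fun n => ?_
  have hW : W = G + C t * (X * W) := by rw [← h]; ring
  induction n with
  | zero =>
    have := congrArg (coeff 0) hW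
    rw [map_add, coeff_C_mul, coeff_zero_X_mul, mul_zero, add_zero] at this
    simp [this]
  | succ n ih =>
    have := congrArg (coeff (n + 1)) hW
    rw [map_add, coeff_C_mul, coeff_succ_X_mul] at this
    rw [Finset.sum_range_succ, ih, this, pow_succ]
    field_simp
    ring

theorem tendsto_coeff_mul_pow {r f : ℝ⟦X⟧} {y v l : ℝ} (hr : r.EvaluatesTo y v)
    (hf : Tendsto (fun n => coeff n f * y ^ n) atTop (𝓝 l)) :
    Tendsto (fun n => coeff n (r * f) * y ^ n) atTop (𝓝 (v * l)) := by
  refine (tendsto_sum_range_mul_of_summable hr.1 hr.2 hf).congr fun n => ?_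
  rw [coeff_mul, Finset.Nat.sum_antidiagonal_eq_sum_range_succ_mk, Finset.sum_mul]
  refine Finset.sum_congr rfl fun i hi => ?_
  have : y ^ n = y ^ i * y ^ (n - i) := by
    rw [← pow_add, Nat.add_sub_cancel' (Nat.lt_succ_iff.1 (Finset.mem_range.1 hi))]
  rw [this]
  ring

/-- Among the solutions of a second-order linear recurrence over `ℝ⟦X⟧`, those whose coefficients
tend to zero are geometric with ratio the root `r` of smaller constant coefficient. -/
theorem eq_mul_of_recurrence {A e c : ℝ} {Q r : ℝ⟦X⟧} {P : ℕ → ℝ⟦X⟧} (hQ : Q ≠ 0)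
    (hr : r = Q * (C A * r ^ 2 + C e * r + C c))
    (hA : 0 < A) (hr0 : 0 < coeff 0 r) (hrc : A * coeff 0 r < c)
    (hP : ∀ i, P (i + 1) = Q * (C e * P (i + 1) + C c * P i + C A * P (i + 2)))
    (hlim : ∀ j, Tendsto (fun i => coeff j (P i)) atTop (𝓝 0)) (i : ℕ) :
    P (i + 1) = r * P i := by
  set E : ℕ → ℝ⟦X⟧ := fun i => P (i + 1) - r * P i with hE
  have hrec : ∀ i, C A * (r * E (i + 1)) = C c * E i := by
    intro i
    refine mul_left_cancel₀ hQ ?_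
    simp only [hE]
    linear_combination (-r) * hP i + P (i + 1) * hr
  have hElim : ∀ j, Tendsto (fun i => coeff j (E i)) atTop (𝓝 0) := by
    intro j
    have h1 : Tendsto (fun i => coeff j (r * P i)) atTop (𝓝 0) := by
      simp only [coeff_mul]
      simpa using tendsto_finsetSum (Finset.HasAntidiagonal.antidiagonal j)
        fun kl _ => (hlim kl.2).const_mul (coeff kl.1 r)
    simpa [hE] using ((tendsto_add_atTop_iff_nat 1).2 (hlim j)).sub h1
  have hzero : ∀ m i, coeff m (E i) = 0 := by
    intro m
    induction m using Nat.strong_induction_on with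
    | _ m ih =>
      have hstep : ∀ i, A * (coeff 0 r * coeff m (E (i + 1))) = c * coeff m (E i) := by
        intro i
        have h := congrArg (coeff m) (hrec i)
        rw [coeff_C_mul, coeff_C_mul, coeff_mul, Finset.sum_eq_single (0, m)] at h
        · exact h
        · rintro ⟨k, l⟩ hkl hne
          have hkl := Finset.HasAntidiagonal.mem_antidiagonal.1 hkl
          simp only at hkl ⊢
          rw [ih l ?_, mul_zero]
          rcases Nat.eq_zero_or_pos k with rfl | hk
          · exact absurd (by rw [← hkl, zero_add]) hne
          · omega
        · intro hn
          exact absurd (Finset.HasAntidiagonal.mem_antidiagonal.2 (zero_add m)) hn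
      have hmono : ∀ i, |coeff m (E i)| ≤ |coeff m (E (i + 1))| := by
        intro i
        have h := congrArg abs (hstep i)
        have hpos := mul_pos hA hr0
        rw [← mul_assoc, abs_mul (A * _), abs_mul c, abs_of_pos hpos,
          abs_of_pos (hpos.trans hrc)] at h
        by_contra! hlt
        nlinarith [abs_nonneg (coeff m (E (i + 1)))]
      intro i
      have h0 : Tendsto (fun n => |coeff m (E n)|) atTop (𝓝 0) := by
        simpa using (hElim m).abs
      have := (monotone_nat_of_le_succ hmono).ge_of_tendsto h0 i
      exact abs_nonpos_iff.1 this
  have : E i = 0 := by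
    ext m
    rw [hzero m i, map_zero]
  exact sub_eq_zero.1 this

end Sequences

theorem kernel_factorization {S : Type*} [CommRing S] {p q mh ml y r : S}
    (hr : r = (1 - q + q * y) *
      ((1 - p) * mh * r ^ 2 + (p * mh + (1 - p) * (1 - mh)) * r + p * (1 - mh))) :
    (y * (1 - (1 - q + q * y) * (p * mh + (1 - p) * (1 - ml))) - (1 - p) * ml * (1 - q + q * y) -
        (1 - p) * mh * y * (1 - q + q * y) * r) * (ml + (mh - ml) * y - mh * y * r) =
      (y - 1) * ((1 - p) * (1 - q) * ml ^ 2 -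
        ml * (1 - mh * (1 - q) - (1 - p) * (1 - q) * (1 - ml) - (1 - p) * q * ml) * y -
        (mh - (1 - p) * ml) * (1 - ml) * q * y ^ 2) := by
  linear_combination (-mh * y ^ 2) * hr

section Queue

open PowerSeries

variable {p q mh ml : ℝ} {pi : ℕ → ℕ → ℝ}

theorem BalanceEquations.level_series (h : BalanceEquations p q mh ml pi) (i : ℕ) :
    mk (pi (i + 1)) = (C (1 - q) + C q * X) *
      (C (p * mh + (1 - p) * (1 - mh)) * mk (pi (i + 1)) + C (p * (1 - mh)) * mk (pi i) +
        C ((1 - p) * mh) * mk (pi (i + 2))) := by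
  obtain ⟨-, h1, -, h2⟩ := h
  generalize he : p * mh + (1 - p) * (1 - mh) = e
  ext n
  rw [add_mul, map_add, coeff_C_mul, mul_assoc, coeff_C_mul]
  cases n with
  | zero =>
    have := h1 (i + 1) (by omega)
    simp only [coeff_zero_X_mul, map_add, coeff_C_mul, coeff_mk, Nat.add_sub_cancel] at this ⊢
    subst he
    linear_combination this
  | succ n =>
    have := h2 (i + 1) (n + 1) (by omega) (by omega)
    simp only [coeff_succ_X_mul, map_add, coeff_C_mul, coeff_mk, Nat.add_sub_cancel] at this ⊢
    subst he
    linear_combination this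

theorem BalanceEquations.boundary_series (h : BalanceEquations p q mh ml pi) :
    X * mk (pi 0) = C (p * mh + (1 - p) * (1 - ml)) * (X * ((C (1 - q) + C q * X) * mk (pi 0))) +
      C ((1 - p) * ml) * ((C (1 - q) + C q * X) * mk (pi 0)) +
      C ((1 - p) * (1 - q) * ml * pi 0 0) * (X - 1) +
      C ((1 - p) * mh) * (X * ((C (1 - q) + C q * X) * mk (pi 1))) := by
  obtain ⟨h0, -, h1, -⟩ := h
  generalize he : p * mh + (1 - p) * (1 - ml) = e
  have hC : ∀ (k : ℕ) (f : ℝ⟦X⟧), coeff k ((C (1 - q) + C q * X) * f) =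
      (1 - q) * coeff k f + q * coeff k (X * f) := fun k f => by
    rw [add_mul, mul_assoc, map_add, coeff_C_mul, coeff_C_mul]
  generalize (C (1 - q) + C q * X : ℝ⟦X⟧) = Q at hC ⊢
  ext n
  rcases n with _ | _ | n
  · simp only [hC, coeff_zero_X_mul, map_add, map_sub, coeff_C_mul, coeff_mk,
      coeff_zero_X, coeff_zero_one]
    ring
  · simp only [hC, coeff_succ_X_mul, coeff_zero_X_mul, map_add, map_sub,
      coeff_C_mul, coeff_mk, coeff_X, coeff_one]
    norm_num
    subst he
    linear_combination h0
  · have := h1 (n + 1) (by omega)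
    simp only [hC, coeff_succ_X_mul, map_add, map_sub,
      coeff_C_mul, coeff_mk, coeff_X, coeff_one, Nat.add_sub_cancel] at this ⊢
    norm_num at this ⊢
    subst he
    linear_combination this

theorem tendsto_level_zero (hsum : Summable fun ij : ℕ × ℕ => pi ij.1 ij.2) (j : ℕ) :
    Filter.Tendsto (fun i => coeff j (mk (pi i))) Filter.atTop (nhds 0) := by
  simp only [coeff_mk]
  have hinj : Function.Injective fun i : ℕ => (i, j) := fun a b hab => congrArg Prod.fst hab
  exact (hsum.comp_injective hinj).tendsto_atTop_zero

theorem bottom_series_mul_eq {r : ℝ⟦X⟧} {eta1 eta2 : ℝ} (hp1 : p < 1) (hq1 : q < 1) (hml : 0 < ml)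
    (hr : r = (C (1 - q) + C q * X) * (C ((1 - p) * mh) * r ^ 2 +
      C (p * mh + (1 - p) * (1 - mh)) * r + C (p * (1 - mh))))
    (h : BalanceEquations p q mh ml pi) (h1 : mk (pi 1) = r * mk (pi 0))
    (hadd : (1 - p) * (1 - q) * ml ^ 2 * (eta1 + eta2) =
      ml * (1 - mh * (1 - q) - (1 - p) * (1 - q) * (1 - ml) - (1 - p) * q * ml))
    (hmul : (1 - p) * (1 - q) * ml ^ 2 * (eta1 * eta2) = -((mh - (1 - p) * ml) * (1 - ml) * q)) :
    mk (pi 0) * (1 - C eta1 * X) * (1 - C eta2 * X) =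
      C (pi 0 0 / ml) * (C ml + C (mh - ml) * X - C mh * (X * r)) := by
  have hb := h.boundary_series
  rw [h1] at hb
  have hfac := kernel_factorization (S := ℝ⟦X⟧) (p := C p) (q := C q) (mh := C mh) (ml := C ml)
    (y := X) (r := r) (by simpa only [map_mul, map_add, map_sub, map_one] using hr)
  have hadd' := congrArg (C : ℝ → ℝ⟦X⟧) hadd
  have hmul' := congrArg (C : ℝ → ℝ⟦X⟧) hmul
  have hdiv : (C (pi 0 0 / ml) : ℝ⟦X⟧) * C ml = C (pi 0 0) := by
    rw [← map_mul, div_mul_cancel₀ _ hml.ne']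
  simp only [map_mul, map_add, map_sub, map_one, map_neg, map_pow] at hb hfac hadd' hmul' hdiv ⊢
  have hX : (X - 1 : ℝ⟦X⟧) ≠ 0 := by
    intro h0
    have := congrArg (coeff 0) h0
    simp at this
  have hK : (C ((1 - p) * (1 - q) * ml ^ 2) : ℝ⟦X⟧) ≠ 0 := by
    rw [Ne, map_eq_zero_iff _ C_injective]
    have := mul_pos (mul_pos (sub_pos.2 hp1) (sub_pos.2 hq1)) (pow_pos hml 2)
    exact this.ne'
  refine mul_left_cancel₀ (mul_ne_zero hX hK) ?_
  simp only [map_mul, map_sub, map_one, map_pow]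
  linear_combination (-(X - 1) * mk (pi 0) * X) * hadd' +
    (X - 1) * mk (pi 0) * X ^ 2 * hmul' - mk (pi 0) * hfac +
    (C ml + (C mh - C ml) * X - C mh * (X * r)) * hb -
    (X - 1) * (1 - C p) * (1 - C q) * C ml *
      (C ml + (C mh - C ml) * X - C mh * (X * r)) * hdiv

end Queue

section RealRoots

variable {p q mh ml : ℝ}

theorem characteristic_roots {eta1 eta2 : ℝ} (hp : p ∈ Set.Ioo (0 : ℝ) 1)
    (hq : q ∈ Set.Ioo (0 : ℝ) 1) (hmh : mh ∈ Set.Ioo (0 : ℝ) 1) (hml : ml ∈ Set.Ioo (0 : ℝ) 1)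
    (hrho : p / mh + q / ml < 1) (hmu : ml ≤ mh)
    (heta1 : eta1 = ((1 - mh*(1-q) - (1-p)*(1-q)*(1-ml) - (1-p)*q*ml)
        + Real.sqrt ((1 - mh*(1-q) - (1-p)*(1-q)*(1-ml) - (1-p)*q*ml)^2
            + 4*(1-p)*(1-q)*(mh - (1-p)*ml)*(1-ml)*q))
        / (2*(1-p)*(1-q)*ml))
    (heta2 : eta2 = ((1 - mh*(1-q) - (1-p)*(1-q)*(1-ml) - (1-p)*q*ml)
        - Real.sqrt ((1 - mh*(1-q) - (1-p)*(1-q)*(1-ml) - (1-p)*q*ml)^2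
            + 4*(1-p)*(1-q)*(mh - (1-p)*ml)*(1-ml)*q))
        / (2*(1-p)*(1-q)*ml)) :
    (1 - p) * (1 - q) * ml ^ 2 * (eta1 + eta2) =
      ml * (1 - mh * (1 - q) - (1 - p) * (1 - q) * (1 - ml) - (1 - p) * q * ml) ∧
    (1 - p) * (1 - q) * ml ^ 2 * (eta1 * eta2) = -((mh - (1 - p) * ml) * (1 - ml) * q) ∧
    0 < eta1 ∧ eta1 < 1 ∧ eta2 < 0 := by
  obtain ⟨hp0, hp1⟩ := hp
  obtain ⟨hq0, hq1⟩ := hq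
  obtain ⟨hmh0, hmh1⟩ := hmh
  obtain ⟨hml0, hml1⟩ := hml
  set B := 1 - mh*(1-q) - (1-p)*(1-q)*(1-ml) - (1-p)*q*ml with hB
  have hgap : 0 < mh - (1 - p) * ml := by nlinarith
  have hpos : 0 < (1-p)*(1-q) := mul_pos (by linarith) (by linarith)
  have hprod : 0 < (1-p)*(1-q)*((mh - (1-p)*ml)*(1-ml)*q) :=
    mul_pos hpos (mul_pos (mul_pos hgap (by linarith)) hq0)
  have hdisc : 0 ≤ B ^ 2 + 4*(1-p)*(1-q)*(mh - (1-p)*ml)*(1-ml)*q := by nlinarith [sq_nonneg B]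
  obtain ⟨s, hs⟩ : ∃ s, s = Real.sqrt (B ^ 2 + 4*(1-p)*(1-q)*(mh - (1-p)*ml)*(1-ml)*q) := ⟨_, rfl⟩
  have hs2 : s ^ 2 = B ^ 2 + 4*(1-p)*(1-q)*(mh - (1-p)*ml)*(1-ml)*q := by
    rw [hs, Real.sq_sqrt hdisc]
  have hs0 : 0 ≤ s := hs ▸ Real.sqrt_nonneg _
  rw [← hs] at heta1 heta2
  have hden : 0 < 2*(1-p)*(1-q)*ml := by nlinarith [mul_pos hpos hml0]
  have hBs : |B| < s := abs_lt_of_sq_lt_sq (by nlinarith) hs0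
  obtain ⟨hB1, hB2⟩ := abs_lt.1 hBs
  have e1 : eta1 * (2*(1-p)*(1-q)*ml) = B + s := by rw [heta1, div_mul_cancel₀ _ hden.ne']
  have e2 : eta2 * (2*(1-p)*(1-q)*ml) = B - s := by rw [heta2, div_mul_cancel₀ _ hden.ne']
  have hadd : (1 - p) * (1 - q) * ml ^ 2 * (eta1 + eta2) = ml * B := by
    linear_combination ml / 2 * (e1 + e2)
  have hmul : (1 - p) * (1 - q) * ml ^ 2 * (eta1 * eta2) =
      -((mh - (1 - p) * ml) * (1 - ml) * q) := by
    refine mul_left_cancel₀ (mul_pos (by norm_num : (0:ℝ) < 4) hpos).ne' ?_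
    linear_combination (eta2 * (2*(1-p)*(1-q)*ml)) * e1 + (B + s) * e2 - hs2
  have h1 : 0 < eta1 := by rw [heta1]; exact div_pos (by linarith) hden
  have h2 : eta2 < 0 := by rw [heta2]; exact div_neg_of_neg_of_pos (by linarith) hden
  refine ⟨hadd, hmul, h1, ?_, h2⟩
  have hstab : 0 < ml * (mh - p) - mh * q := by
    rw [div_add_div _ _ hmh0.ne' hml0.ne', div_lt_one (mul_pos hmh0 hml0)] at hrho
    linarith
  have hat1 : ((1 - p) * (1 - q) * ml ^ 2 * (1 - eta2)) * (1 - eta1) =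
      ml * (mh - p) - mh * q := by
    rw [hB] at hadd
    linear_combination -hadd + hmul
  have : 0 < (1 - p) * (1 - q) * ml ^ 2 * (1 - eta2) :=
    mul_pos (mul_pos hpos (by positivity)) (by linarith)
  have := (mul_pos_iff_of_pos_left this).1 (hat1 ▸ hstab)
  linarith

theorem branch_point_spec {y0 : ℝ} (hp : p ∈ Set.Ioo (0 : ℝ) 1) (hq0 : 0 < q)
    (hmh : mh ∈ Set.Ioo (0 : ℝ) 1) (hpmh : p < mh) (hne : p + mh < 1)
    (hy0 : y0 = (p*mh + (1-p)*(1-mh) - 2*Real.sqrt (p*mh*(1-p)*(1-mh)))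
        / ((p*mh - (1-p)*(1-mh))^2 * q) - (1-q)/q) :
    ∃ σ, 0 < σ ∧ σ ^ 2 = (1 - p) * mh * (p * (1 - mh)) ∧
      (1 - q + q * y0) * (p * mh + (1 - p) * (1 - mh) + 2 * σ) = 1 ∧ 1 < y0 := by
  obtain ⟨hp0, hp1⟩ := hp
  obtain ⟨hmh0, hmh1⟩ := hmh
  have hprod : 0 < p*mh*(1-p)*(1-mh) :=
    mul_pos (mul_pos (mul_pos hp0 hmh0) (by linarith)) (by linarith)
  set σ := Real.sqrt (p*mh*(1-p)*(1-mh)) with hσ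
  have hσ0 : 0 < σ := Real.sqrt_pos.2 hprod
  have hσ2 : σ ^ 2 = p*mh*(1-p)*(1-mh) := Real.sq_sqrt hprod.le
  have he : 0 < p * mh + (1 - p) * (1 - mh) := by
    have := mul_pos hp0 hmh0
    have := mul_pos (sub_pos.2 hp1) (sub_pos.2 hmh1)
    linarith
  have hd : (p*mh - (1-p)*(1-mh))^2 ≠ 0 := by
    refine pow_ne_zero 2 ?_
    have : p*mh - (1-p)*(1-mh) = p + mh - 1 := by ring
    rw [this]
    linarith
  have hQ : (1 - q + q * y0) * (p*mh - (1-p)*(1-mh))^2 = p*mh + (1-p)*(1-mh) - 2*σ := by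
    generalize (p*mh - (1-p)*(1-mh))^2 = d at hy0 hd ⊢
    rw [hy0]
    field_simp
    ring
  have hQ1 : (1 - q + q * y0) * (p * mh + (1 - p) * (1 - mh) + 2 * σ) = 1 := by
    refine mul_right_cancel₀ hd ?_
    linear_combination (p * mh + (1 - p) * (1 - mh) + 2 * σ) * hQ - 4 * hσ2
  have hlt : p * mh + (1 - p) * (1 - mh) + 2 * σ < 1 := by
    have hpos : 0 < (1 - p) * mh + p * (1 - mh) := by
      have := mul_pos (sub_pos.2 hp1) hmh0
      have := mul_pos hp0 (sub_pos.2 hmh1)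
      linarith
    have : 2 * σ < (1 - p) * mh + p * (1 - mh) := by
      refine lt_of_pow_lt_pow_left₀ 2 hpos.le ?_
      have : 0 < (mh - p) ^ 2 := by have := sub_pos.2 hpmh; positivity
      nlinarith
    linarith
  refine ⟨σ, hσ0, by rw [hσ2]; ring, hQ1, ?_⟩
  by_contra! hle
  nlinarith [mul_nonneg (mul_nonneg hq0.le (sub_nonneg.2 hle)) (add_pos he hσ0).le,
    mul_nonneg (mul_nonneg hq0.le (sub_nonneg.2 hle)) hσ0.le]

/-- If `F y0 > 0` at the branch point `y0`, the characteristic root `1 / η₁` lies below `y0`, on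
the branch where `F` is nonnegative. -/
theorem root_lt_branch_point {F : ℝ → ℝ} {y0 eta1 eta2 σ : ℝ} (hp1 : p < 1) (hml0 : 0 < ml)
    (hq : q ∈ Set.Ioo (0 : ℝ) 1)
    (hF : ∀ y, F y = ((1-p) + mh - 2*(1-p)*ml)*q*y^2
        + (((1-p) + mh - 2*(1-p)*ml)*(1-q) + 2*(1-p)*q*ml - 1)*y
        + 2*(1-p)*(1-q)*ml)
    (he : 0 < p * mh + (1 - p) * (1 - mh))
    (hadd : (1 - p) * (1 - q) * ml ^ 2 * (eta1 + eta2) =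
      ml * (1 - mh * (1 - q) - (1 - p) * (1 - q) * (1 - ml) - (1 - p) * q * ml))
    (hmul : (1 - p) * (1 - q) * ml ^ 2 * (eta1 * eta2) = -((mh - (1 - p) * ml) * (1 - ml) * q))
    (h0 : 0 < eta1) (h1 : eta1 < 1) (h2 : eta2 < 0)
    (hσ0 : 0 < σ) (hσ2 : σ ^ 2 = (1 - p) * mh * (p * (1 - mh)))
    (hQ1 : (1 - q + q * y0) * (p * mh + (1 - p) * (1 - mh) + 2 * σ) = 1) (hy1 : 1 < y0)
    (hFy0 : 0 < F y0) :
    eta1⁻¹ < y0 ∧ 0 ≤ F eta1⁻¹ ∧ F eta1⁻¹ ^ 2 = eta1⁻¹ ^ 2 *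
      ((1 - (1 - q + q * eta1⁻¹) * (p * mh + (1 - p) * (1 - mh))) ^ 2 -
        4 * (1 - q + q * eta1⁻¹) ^ 2 * ((1 - p) * mh * (p * (1 - mh)))) := by
  obtain ⟨hq0, hq1⟩ := hq
  have hid : ∀ y, F y ^ 2 - y ^ 2 *
      ((1 - (1 - q + q * y) * (p * mh + (1 - p) * (1 - mh))) ^ 2 -
        4 * (1 - q + q * y) ^ 2 * ((1 - p) * mh * (p * (1 - mh)))) =
      4 * (1 - p) * (1 - q + q * y) * ((1 - p) * (1 - q) * ml ^ 2) * (y - 1) *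
        (1 - eta2 * y) * (eta1 * y - 1) := by
    intro y
    rw [hF]
    linear_combination (-4 * (1 - p) * (1 - q + q * y) * (y - 1) * y) * hadd +
      (4 * (1 - p) * (1 - q + q * y) * (y - 1) * y ^ 2) * hmul
  have hfac : ∀ y, 1 < y → 0 < 4 * (1 - p) * (1 - q + q * y) * ((1 - p) * (1 - q) * ml ^ 2) *
      (y - 1) * (1 - eta2 * y) := by
    intro y hy
    have a1 : 0 < 1 - p := by linarith
    have a2 : 0 < 1 - q := by linarith
    have a3 : 0 < y - 1 := by linarith
    have a4 : 0 < 1 - eta2 * y := by nlinarith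
    have a5 : 0 < 1 - q + q * y := by nlinarith
    positivity
  have hΔ : ∀ y, 0 ≤ y → y ≤ y0 →
      0 ≤ (1 - (1 - q + q * y) * (p * mh + (1 - p) * (1 - mh))) ^ 2 -
        4 * (1 - q + q * y) ^ 2 * ((1 - p) * mh * (p * (1 - mh))) := by
    intro y hy hle
    have hQ0 : 0 < 1 - q + q * y := by nlinarith
    have b1 : 0 ≤ 1 - (1 - q + q * y) * (p * mh + (1 - p) * (1 - mh) + 2 * σ) :=
      le_of_le_of_eq (mul_nonneg (mul_nonneg hq0.le (sub_nonneg.2 hle))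
        (add_nonneg he.le (by linarith : 0 ≤ 2 * σ))) (by linear_combination hQ1)
    have b2 : 0 ≤ (1 - q + q * y) * (4 * σ) := by positivity
    rw [← hσ2]
    exact le_of_le_of_eq (mul_nonneg b1 (add_nonneg b1 b2)) (by ring)
  have hR1 : 1 < eta1⁻¹ := (one_lt_inv₀ h0).2 h1
  have hlt : eta1⁻¹ < y0 := by
    have h := hid y0
    have hz : (1 - (1 - q + q * y0) * (p * mh + (1 - p) * (1 - mh))) ^ 2 -
        4 * (1 - q + q * y0) ^ 2 * ((1 - p) * mh * (p * (1 - mh))) = 0 := by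
      rw [← hσ2]
      linear_combination (-(1 - (1 - q + q * y0) * (p * mh + (1 - p) * (1 - mh))) -
        2 * (1 - q + q * y0) * σ) * hQ1
    rw [hz, mul_zero, sub_zero] at h
    have := (mul_pos_iff_of_pos_left (hfac y0 hy1)).1 (h ▸ pow_pos hFy0 2)
    rw [inv_lt_iff_one_lt_mul₀ h0]
    linarith
  refine ⟨hlt, ?_, ?_⟩
  · by_contra! hneg
    have hcont : ContinuousOn F (Set.Icc eta1⁻¹ y0) := by
      rw [show F = _ from funext hF]
      fun_prop
    obtain ⟨y, ⟨hy, hy'⟩, hFy⟩ := intermediate_value_Ioo hlt.le hcont ⟨hneg, hFy0⟩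
    have h := hid y
    have hpos : 0 < eta1 * y - 1 := by
      rw [inv_lt_iff_one_lt_mul₀ h0] at hy
      linarith
    have := mul_pos (hfac y (hR1.trans hy)) hpos
    rw [← h, hFy, zero_pow two_ne_zero, zero_sub, neg_pos] at this
    exact absurd this (not_lt.2 (mul_nonneg (sq_nonneg y) (hΔ y (by linarith) hy'.le)))
  · have h := hid eta1⁻¹
    rw [mul_inv_cancel₀ h0.ne', sub_self, mul_zero] at h
    linarith

end RealRoots

section Limits

open PowerSeries Filter Topology

variable {p q mh ml : ℝ}

/-- The values at `y = 1 / η₁` of the kernel root and of the numerator of the generating function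
of the boundary level, when the kernel root lies on the branch where `F` is nonnegative. -/
theorem values_at_pole {F : ℝ → ℝ} {eta1 ρ : ℝ} (hp : p ∈ Set.Ioo (0 : ℝ) 1)
    (hq : q ∈ Set.Ioo (0 : ℝ) 1) (hmh : mh ∈ Set.Ioo (0 : ℝ) 1) (hml0 : 0 < ml) (hmu : ml ≤ mh)
    (hF : ∀ y, F y = ((1-p) + mh - 2*(1-p)*ml)*q*y^2
        + (((1-p) + mh - 2*(1-p)*ml)*(1-q) + 2*(1-p)*q*ml - 1)*y
        + 2*(1-p)*(1-q)*ml)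
    (h0 : 0 < eta1) (hF0 : 0 ≤ F eta1⁻¹)
    (hF2 : F eta1⁻¹ ^ 2 = eta1⁻¹ ^ 2 *
      ((1 - (1 - q + q * eta1⁻¹) * (p * mh + (1 - p) * (1 - mh))) ^ 2 -
        4 * (1 - q + q * eta1⁻¹) ^ 2 * ((1 - p) * mh * (p * (1 - mh)))))
    (hρ : ρ = (1 - q + q * eta1⁻¹) *
      ((1 - p) * mh * ρ ^ 2 + (p * mh + (1 - p) * (1 - mh)) * ρ + p * (1 - mh)))
    (hs : 0 < 1 - (1 - q + q * eta1⁻¹) * (p * mh + (1 - p) * (1 - mh)) -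
      2 * ((1 - p) * mh) * (1 - q + q * eta1⁻¹) * ρ) :
    (1 - q + q * eta1⁻¹) *
      (p * mh + (1 - p) * (1 - ml) + (1 - p) * ml * eta1 + (1 - p) * mh * ρ) = 1 ∧
    (1 - (p*mh + (1-p)*(1-ml)) * (q/eta1 + 1 - q) - (1-p)*ml*(q + (1-q)*eta1))
          / ((1-p)*mh*(q/eta1 + 1 - q)) = ρ ∧
    p*(1-mh) / ((1-p)*mh - (1-p)*ml*(1 - eta1)) = ρ ∧
    F eta1⁻¹ = (1 - p) * (1 - q + q * eta1⁻¹) *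
      (ml + (mh - ml) * eta1⁻¹ - mh * (eta1⁻¹ * ρ)) := by
  obtain ⟨hp0, hp1⟩ := hp
  obtain ⟨hq0, hq1⟩ := hq
  obtain ⟨hmh0, hmh1⟩ := hmh
  have hdiv : q / eta1 + 1 - q = 1 - q + q * eta1⁻¹ := by rw [div_eq_mul_inv]; ring
  rw [hdiv]
  have hRη : eta1⁻¹ * eta1 = 1 := inv_mul_cancel₀ h0.ne'
  have hR0 : 0 < eta1⁻¹ := inv_pos.2 h0
  generalize eta1⁻¹ = R at *
  have hQ0 : 0 < 1 - q + q * R := add_pos (sub_pos.2 hq1) (mul_pos hq0 hR0)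
  have hFs : F R = R * (1 - (1 - q + q * R) * (p * mh + (1 - p) * (1 - mh)) -
      2 * ((1 - p) * mh) * (1 - q + q * R) * ρ) := by
    refine (pow_left_inj₀ hF0 (mul_pos hR0 hs).le two_ne_zero).1 ?_
    rw [hF2]
    linear_combination (4 * R ^ 2 * (1 - q + q * R) * ((1 - p) * mh)) * hρ
  have hD : (1 - q + q * R) *
      (p * mh + (1 - p) * (1 - ml) + (1 - p) * ml * eta1 + (1 - p) * mh * ρ) = 1 := by
    rw [hF] at hFs
    refine mul_left_cancel₀ hR0.ne' ?_
    linear_combination hFs / 2 + (1 - q + q * R) * (1 - p) * ml * hRη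
  refine ⟨hD, ?_, ?_, ?_⟩
  · have : 0 < (1 - p) * mh * (1 - q + q * R) :=
      mul_pos (mul_pos (by linarith) hmh0) hQ0
    rw [div_eq_iff this.ne']
    linear_combination -hD + (1 - p) * ml * q * hRη
  · have h1 : 0 < (1 - p) * ml * eta1 := mul_pos (mul_pos (by linarith) hml0) h0
    have h2 : 0 ≤ (1 - p) * (mh - ml) := mul_nonneg (by linarith) (by linarith)
    have h3 : (1-p)*mh - (1-p)*ml*(1 - eta1) = (1 - p) * (mh - ml) + (1 - p) * ml * eta1 := by ring
    rw [div_eq_iff (by rw [h3]; exact (add_pos_of_nonneg_of_pos h2 h1).ne')]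
    refine mul_left_cancel₀ hQ0.ne' ?_
    linear_combination -hρ - ρ * hD
  · rw [hF]
    rw [hF] at hFs
    linear_combination hFs / 2

theorem numerator_eq_zero {eta1 eta2 ρ ρ' : ℝ} (hp : p ∈ Set.Ioo (0 : ℝ) 1)
    (hq : q ∈ Set.Ioo (0 : ℝ) 1) (hmh : mh ∈ Set.Ioo (0 : ℝ) 1) (hml : ml ∈ Set.Ioo (0 : ℝ) 1)
    (hadd : (1 - p) * (1 - q) * ml ^ 2 * (eta1 + eta2) =
      ml * (1 - mh * (1 - q) - (1 - p) * (1 - q) * (1 - ml) - (1 - p) * q * ml))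
    (hmul : (1 - p) * (1 - q) * ml ^ 2 * (eta1 * eta2) = -((mh - (1 - p) * ml) * (1 - ml) * q))
    (h0 : 0 < eta1) (h12 : eta2 = -eta1) (hρρ : |ρ'| ≤ ρ)
    (hρ' : ρ' = (1 - q + q * -eta1⁻¹) *
      ((1 - p) * mh * ρ' ^ 2 + (p * mh + (1 - p) * (1 - mh)) * ρ' + p * (1 - mh)))
    (hD : (1 - q + q * eta1⁻¹) *
      (p * mh + (1 - p) * (1 - ml) + (1 - p) * ml * eta1 + (1 - p) * mh * ρ) = 1) :
    ml + (mh - ml) * -eta1⁻¹ - mh * (-eta1⁻¹ * ρ') = 0 := by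
  obtain ⟨hp0, hp1⟩ := hp
  obtain ⟨hq0, hq1⟩ := hq
  obtain ⟨hmh0, hmh1⟩ := hmh
  obtain ⟨hml0, hml1⟩ := hml
  have hRη : eta1⁻¹ * eta1 = 1 := inv_mul_cancel₀ h0.ne'
  have hR0 : 0 < eta1⁻¹ := inv_pos.2 h0
  have hfac := kernel_factorization (ml := ml) hρ'
  subst h12
  generalize eta1⁻¹ = R at *
  have hfac' : ((1 - q + q * -R) * (p * mh + (1 - p) * (1 - ml) - (1 - p) * ml * eta1 +
      (1 - p) * mh * ρ') - 1) * R * (ml + (mh - ml) * -R - mh * (-R * ρ')) = 0 := by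
    have hz : (-R - 1) * ((1 - p) * (1 - q) * ml ^ 2 -
        ml * (1 - mh * (1 - q) - (1 - p) * (1 - q) * (1 - ml) - (1 - p) * q * ml) * -R -
        (mh - (1 - p) * ml) * (1 - ml) * q * (-R) ^ 2) = 0 := by
      linear_combination (-R - 1) * (-R * hadd - R ^ 2 * hmul -
        (1 - p) * (1 - q) * ml ^ 2 * (R * eta1 + 1) * hRη)
    rw [hz] at hfac
    linear_combination hfac - (1 - q + q * -R) * (1 - p) * ml *
      (ml + (mh - ml) * -R - mh * (-R * ρ')) * hRη
  have hne : (1 - q + q * -R) * (p * mh + (1 - p) * (1 - ml) - (1 - p) * ml * eta1 +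
      (1 - p) * mh * ρ') < 1 := by
    have hQ : |1 - q + q * -R| < 1 - q + q * R := by
      have hqR := mul_pos hq0 hR0
      rw [mul_neg, abs_lt]
      constructor <;> linarith
    have hA : 0 < (1 - p) * mh := mul_pos (by linarith) hmh0
    have c1 : 0 < p * mh := mul_pos hp0 hmh0
    have c2 : 0 < (1 - p) * (1 - ml) := mul_pos (by linarith) (by linarith)
    have c3 : 0 < (1 - p) * ml * eta1 := mul_pos (mul_pos (by linarith) hml0) h0
    obtain ⟨d1, d2⟩ := abs_le.1 hρρ
    have d3 := mul_le_mul_of_nonneg_left d1 hA.le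
    have d4 := mul_le_mul_of_nonneg_left d2 hA.le
    have hM : |p * mh + (1 - p) * (1 - ml) - (1 - p) * ml * eta1 + (1 - p) * mh * ρ'| ≤
        p * mh + (1 - p) * (1 - ml) + (1 - p) * ml * eta1 + (1 - p) * mh * ρ := by
      rw [abs_le]
      constructor <;> linarith
    have hM0 : 0 < p * mh + (1 - p) * (1 - ml) + (1 - p) * ml * eta1 + (1 - p) * mh * ρ := by
      have := mul_nonneg hA.le ((abs_nonneg _).trans hρρ)
      linarith
    refine (le_abs_self _).trans_lt ?_
    rw [abs_mul]
    calc _ ≤ |1 - q + q * -R| *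
          (p * mh + (1 - p) * (1 - ml) + (1 - p) * ml * eta1 + (1 - p) * mh * ρ) :=
          mul_le_mul_of_nonneg_left hM (abs_nonneg _)
      _ < _ := mul_lt_mul_of_pos_right hQ hM0
      _ = 1 := hD
  rcases mul_eq_zero.1 hfac' with h | h
  · rcases mul_eq_zero.1 h with h | h
    · linarith
    · exact absurd h hR0.ne'
  · exact h

theorem PowerSeries.EvaluatesTo.kernel_eq {A e c y v : ℝ} {r : ℝ⟦X⟧} (hv : r.EvaluatesTo y v)
    (hr : r = (C (1 - q) + C q * PowerSeries.X) * (C A * r ^ 2 + C e * r + C c)) :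
    v = (1 - q + q * y) * (A * v ^ 2 + e * v + c) := by
  have h := ((EvaluatesTo.const (1 - q) y).add ((EvaluatesTo.const q y).mul (.X y))).mul
    ((((EvaluatesTo.const A y).mul (hv.mul hv)).add
      ((EvaluatesTo.const e y).mul hv)).add (EvaluatesTo.const c y))
  rw [← pow_two, ← hr, ← pow_two] at h
  exact hv.unique h

theorem kernel_root_evaluates {A e c σ y : ℝ} {r : ℝ⟦X⟧} (hA : 0 < A) (he : 0 < e) (hc : 0 < c)
    (hq0 : 0 < q) (hq1 : q < 1) (hnn : ∀ n, 0 ≤ coeff n r)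
    (hr : r = (C (1 - q) + C q * X) * (C A * r ^ 2 + C e * r + C c))
    (hs : 0 < 1 - (1 - q) * e - 2 * (1 - q) * A * coeff 0 r)
    (hσ0 : 0 < σ) (hσ2 : σ ^ 2 = A * c) (hy : 0 ≤ y)
    (hlt : (1 - q + q * y) * (e + 2 * σ) < 1) :
    ∃ v, r.EvaluatesTo y v ∧ 0 < 1 - (1 - q + q * y) * e - 2 * A * (1 - q + q * y) * v := by
  have hm : ∀ z, 0 ≤ z → z ≤ y → (1 - q + q * z) * (A * (σ / A) ^ 2 + e * (σ / A) + c) < σ / A := by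
    intro z hz hzy
    have hc' : c = A * (σ / A) ^ 2 := by field_simp; linarith
    have h1 : (1 - q + q * z) * (e + 2 * σ) < 1 := by
      refine lt_of_le_of_lt (mul_le_mul_of_nonneg_right ?_ (by linarith)) hlt
      nlinarith
    have h2 : (1 - q + q * z) * (A * (σ / A) ^ 2 + e * (σ / A) + c) =
        (1 - q + q * z) * (e + 2 * σ) * (σ / A) := by
      have : A * (σ / A) = σ := mul_div_cancel₀ _ hA.ne'
      rw [hc']
      linear_combination (2 * (1 - q + q * z) * (σ / A)) * this
    rw [h2]
    exact mul_lt_of_lt_one_left (div_pos hσ0 hA) h1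
  have hr0 : coeff 0 r < σ / A := by
    by_contra! hle
    have h1 := hm 0 le_rfl hy
    have h2 : coeff 0 r = (1 - q) * (A * coeff 0 r ^ 2 + e * coeff 0 r + c) := by
      have := congrArg constantCoeff hr
      simpa using this
    have hqA : 0 < (1 - q) * A := mul_pos (by linarith) hA
    rw [mul_zero, add_zero] at h1
    generalize σ / A = m at *
    have : 0 ≤ (coeff 0 r - m) * (1 - (1 - q) * e - 2 * (1 - q) * A * coeff 0 r +
        (1 - q) * A * (coeff 0 r - m)) :=
      mul_nonneg (by linarith) (add_nonneg hs.le (mul_nonneg hqA.le (by linarith)))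
    linarith
  have hpart := kernel_root_partial_sum_lt hA he hc hq0 hq1 hnn hr hr0 (div_pos hσ0 hA) hy hm
  have hnn' : ∀ n, 0 ≤ coeff n r * y ^ n := fun n => mul_nonneg (hnn n) (pow_nonneg hy n)
  have hsum : Summable fun n => coeff n r * y ^ n :=
    summable_of_sum_range_le hnn' fun n => (hpart n).le
  refine ⟨_, ⟨hsum.norm, hsum.hasSum⟩, ?_⟩
  have hv := Real.tsum_le_of_sum_range_le hnn' fun n => (hpart n).le
  have hQ0 : 0 < 1 - q + q * y := by nlinarith
  have h3 : 2 * A * (1 - q + q * y) * (∑' n, coeff n r * y ^ n) ≤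
      2 * A * (1 - q + q * y) * (σ / A) :=
    mul_le_mul_of_nonneg_left hv (by positivity)
  have h4 : 2 * A * (1 - q + q * y) * (σ / A) = 2 * (1 - q + q * y) * σ := by field_simp
  linarith

theorem PowerSeries.EvaluatesTo.neg_of_nonneg {r : ℝ⟦X⟧} {y v : ℝ} (hnn : ∀ n, 0 ≤ coeff n r)
    (hy : 0 ≤ y) (hv : r.EvaluatesTo y v) : ∃ w, r.EvaluatesTo (-y) w ∧ |w| ≤ v := by
  have hnorm : ∀ n, ‖coeff n r * (-y) ^ n‖ = coeff n r * y ^ n := fun n => by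
    rw [norm_mul, norm_pow, norm_neg, Real.norm_of_nonneg (hnn n), Real.norm_of_nonneg hy]
  have hs : Summable fun n => ‖coeff n r * (-y) ^ n‖ := by simpa only [hnorm] using hv.2.summable
  refine ⟨_, ⟨hs, hs.of_norm.hasSum⟩, ?_⟩
  have := norm_tsum_le_tsum_norm hs
  simp only [hnorm] at this
  rwa [hv.2.tsum_eq, Real.norm_eq_abs] at this

end Limits

open PowerSeries Filter Topology in
/-- exact geometric decay of the joint probabilities along the
low-priority direction when `F(y_0) > 0`, for each fixed `i ≥ 1`. -/
theorem tail_joint_geometric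
    (p q mh ml : ℝ)
    (hp : p ∈ Set.Ioo (0:ℝ) 1) (hq : q ∈ Set.Ioo (0:ℝ) 1)
    (hmh : mh ∈ Set.Ioo (0:ℝ) 1) (hml : ml ∈ Set.Ioo (0:ℝ) 1)
    (hpar : p + q + mh + ml = 1)
    (hrho : p / mh + q / ml < 1)
    (hmu : ml ≤ mh)
    (F : ℝ → ℝ)
    (hF : ∀ y, F y = ((1-p) + mh - 2*(1-p)*ml)*q*y^2
        + (((1-p) + mh - 2*(1-p)*ml)*(1-q) + 2*(1-p)*q*ml - 1)*y
        + 2*(1-p)*(1-q)*ml)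
    (y0 y1 : ℝ)
    (hy0 : y0 = (p*mh + (1-p)*(1-mh) - 2*Real.sqrt (p*mh*(1-p)*(1-mh)))
        / ((p*mh - (1-p)*(1-mh))^2 * q) - (1-q)/q)
    (hy1 : y1 = (p*mh + (1-p)*(1-mh) + 2*Real.sqrt (p*mh*(1-p)*(1-mh)))
        / ((p*mh - (1-p)*(1-mh))^2 * q) - (1-q)/q)
    (eta1 eta2 : ℝ)
    (heta1 : eta1 = ((1 - mh*(1-q) - (1-p)*(1-q)*(1-ml) - (1-p)*q*ml)
        + Real.sqrt ((1 - mh*(1-q) - (1-p)*(1-q)*(1-ml) - (1-p)*q*ml)^2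
            + 4*(1-p)*(1-q)*(mh - (1-p)*ml)*(1-ml)*q))
        / (2*(1-p)*(1-q)*ml))
    (heta2 : eta2 = ((1 - mh*(1-q) - (1-p)*(1-q)*(1-ml) - (1-p)*q*ml)
        - Real.sqrt ((1 - mh*(1-q) - (1-p)*(1-q)*(1-ml) - (1-p)*q*ml)^2
            + 4*(1-p)*(1-q)*(mh - (1-p)*ml)*(1-ml)*q))
        / (2*(1-p)*(1-q)*ml))
    (pi : ℕ → ℕ → ℝ)
    (hnn : ∀ i j : ℕ, 0 ≤ pi i j)
    (hsum : HasSum (fun ij : ℕ × ℕ => pi ij.1 ij.2) 1)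
    (hbal : BalanceEquations p q mh ml pi)
    (a b : ℝ)
    (ha : a = (pi 0 0 / (2*(1-p)*ml)) * (eta1 / (eta1 - eta2)))
    (hb : b = (pi 0 0 / (2*(1-p)*ml)) * (eta2 / (eta2 - eta1)))
    (hFy0 : 0 < F y0)
    (Cl1 : ℝ)
    (hCl1 : Cl1 = 2 * a * F (1/eta1) / (q/eta1 + 1 - q))
    (Ci1 : ℕ → ℝ)
    (hCi1 : ∀ i : ℕ, Ci1 i =
        ((1 - (p*mh + (1-p)*(1-ml)) * (q/eta1 + 1 - q)
            - (1-p)*ml*(q + (1-q)*eta1))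
          / ((1-p)*mh*(q/eta1 + 1 - q)))
        * (p*(1-mh) / ((1-p)*mh - (1-p)*ml*(1 - eta1))) ^ (i - 1)
        * Cl1) :
    ∀ i : ℕ, 1 ≤ i →
      Filter.Tendsto (fun j : ℕ => pi i j / eta1 ^ j) Filter.atTop
        (nhds (Ci1 i)) := by
  intro i hi
  obtain ⟨hadd, hmul, h0, h1, h2⟩ := characteristic_roots hp hq hmh hml hrho hmu heta1 heta2
  have hpmh : p < mh := by
    have := div_pos hq.1 hml.1
    exact (div_lt_one hmh.1).1 (by linarith)
  obtain ⟨σ, hσ0, hσ2, hQ1, hy01⟩ := branch_point_spec hp hq.1 hmh hpmh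
    (by linarith [hq.1, hml.1]) hy0
  have hp1 := sub_pos.2 hp.2
  have hA : 0 < (1 - p) * mh := mul_pos hp1 hmh.1
  have hc : 0 < p * (1 - mh) := mul_pos hp.1 (sub_pos.2 hmh.2)
  have he : 0 < p * mh + (1 - p) * (1 - mh) :=
    add_pos (mul_pos hp.1 hmh.1) (mul_pos hp1 (sub_pos.2 hmh.2))
  obtain ⟨hlt, hF0, hF2⟩ := root_lt_branch_point hp.2 hml.1 hq hF he hadd hmul h0 h1 h2 hσ0 hσ2
    hQ1 hy01 hFy0
  obtain ⟨r, hrnn, hr, hr0, hrc, hrs⟩ := exists_kernel_root_series hA he hc hq.1 hq.2 (by ring)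
  have hQ : (C (1 - q) + C q * X : ℝ⟦X⟧) ≠ 0 := fun hz => by
    have := congrArg (coeff 1) hz
    simp [coeff_C] at this
    exact hq.1.ne' this
  have hgeom := eq_mul_of_recurrence (P := fun i => mk (pi i)) hQ hr hA hr0 hrc
    hbal.level_series (tendsto_level_zero hsum.summable)
  have hbot := bottom_series_mul_eq hp.2 hq.2 hml.1 hr hbal (hgeom 0) hadd hmul
  have hR0 : 0 < eta1⁻¹ := inv_pos.2 h0
  obtain ⟨ρ, hρ, hρs⟩ := kernel_root_evaluates (y := eta1⁻¹) hA he hc hq.1 hq.2 hrnn hr hrs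
    hσ0 hσ2 hR0.le
      (lt_of_lt_of_eq (mul_lt_mul_of_pos_right (by linarith [mul_lt_mul_of_pos_left hlt hq.1])
        (by linarith)) hQ1)
  obtain ⟨hD, hfirst, hratio, hFval⟩ := values_at_pole hp hq hmh hml.1 hmu hF h0 hF0 hF2
    (hρ.kernel_eq hr) hρs
  obtain ⟨ρ', hρ', hρρ⟩ := hρ.neg_of_nonneg hrnn hR0.le
  have hH : ∀ {y v : ℝ}, r.EvaluatesTo y v →
      (C (pi 0 0 / ml) * (C ml + C (mh - ml) * X - C mh * (X * r)) : ℝ⟦X⟧).EvaluatesTo y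
        (pi 0 0 / ml * (ml + (mh - ml) * y - mh * (y * v))) := by
    intro y v hv
    have h := (EvaluatesTo.const (pi 0 0 / ml) y).mul (((EvaluatesTo.const ml y).add
      ((EvaluatesTo.const (mh - ml) y).mul (.X y))).add
        ((EvaluatesTo.const (-mh) y).mul ((EvaluatesTo.X y).mul hv)))
    simpa only [map_neg, neg_mul, ← sub_eq_add_neg] using h
  -- the limit along the boundary level
  have hbase : Tendsto (fun j => coeff j (mk (pi 0)) * eta1⁻¹ ^ j) atTop (𝓝 Cl1) := by
    have hshift : ∀ t n, coeff (n + 1) (mk (pi 0) * (1 - C t * X)) =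
        pi 0 (n + 1) - t * pi 0 n := by
      intro t n
      rw [show mk (pi 0) * (1 - C t * X) = mk (pi 0) - C t * (X * mk (pi 0)) by ring, map_sub,
        coeff_C_mul, coeff_succ_X_mul, coeff_mk, coeff_mk]
    have hmain := tendsto_coeff_mul_inv_pow (W := mk (pi 0) * (1 - C eta2 * X)) h0.ne'
      (by rw [← hbot]; ring) (hH hρ)
    have hlim := tendsto_of_tendsto_succ_add_mul
      (x := fun j => coeff j (mk (pi 0)) * eta1⁻¹ ^ j) (t := -eta2 * eta1⁻¹)
      (fun j => mul_nonneg (by simpa using hnn 0 j) (pow_nonneg hR0.le j))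
      (mul_pos (by linarith) hR0)
      (((tendsto_add_atTop_iff_nat 1).2 hmain).congr fun n => by
        rw [hshift, coeff_mk, coeff_mk, pow_succ]
        ring)
      (fun ht => by
        have h12 : eta2 = -eta1 := by
          rw [← div_eq_mul_inv, div_eq_one_iff_eq h0.ne'] at ht
          linarith
        have hne : -eta1 ≠ 0 := neg_ne_zero.2 h0.ne'
        have hz := hH hρ'
        rw [numerator_eq_zero hp hq hmh hml hadd hmul h0 h12 hρρ (hρ'.kernel_eq hr) hD, mul_zero,
          ← inv_neg] at hz
        have hV := tendsto_coeff_mul_inv_pow (W := mk (pi 0) * (1 - C eta1 * X)) hne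
          (by rw [← hbot, h12]) hz
        rw [← tendsto_add_atTop_iff_nat 1, tendsto_zero_iff_abs_tendsto_zero] at hV
        rw [tendsto_zero_iff_abs_tendsto_zero]
        refine hV.congr fun n => ?_
        simp only [Function.comp_apply]
        rw [hshift, abs_mul, abs_pow, inv_neg, abs_neg, abs_of_pos hR0, coeff_mk, coeff_mk,
          ← abs_of_pos (pow_pos hR0 (n + 1)), ← abs_mul, abs_of_pos (pow_pos hR0 (n + 1)),
          pow_succ]
        congr 1
        field_simp)
    convert hlim using 2
    have hQ0 : 0 < 1 - q + q * eta1⁻¹ := add_pos (sub_pos.2 hq.2) (mul_pos hq.1 hR0)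
    have h3 : eta1 - eta2 ≠ 0 := (by linarith : 0 < eta1 - eta2).ne'
    have h4 : 1 + -eta2 * eta1⁻¹ = (eta1 - eta2) / eta1 := by field_simp; ring
    rw [hCl1, ha, one_div, hFval, h4,
      show q / eta1 + 1 - q = 1 - q + q * eta1⁻¹ by rw [div_eq_mul_inv]; ring]
    generalize ml + (mh - ml) * eta1⁻¹ - mh * (eta1⁻¹ * ρ) = v
    generalize 1 - q + q * eta1⁻¹ = Q at *
    have hml' := hml.1.ne'
    have hp' := hp1.ne'
    have h0' := h0.ne'
    field_simp
  have hall : ∀ k, Tendsto (fun j => coeff j (mk (pi k)) * eta1⁻¹ ^ j) atTop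
      (𝓝 (ρ ^ k * Cl1)) := by
    intro k
    induction k with
    | zero => simpa using hbase
    | succ k ih =>
      have h := tendsto_coeff_mul_pow hρ ih
      rw [← hgeom k, ← mul_assoc, ← pow_succ'] at h
      exact h
  rw [hCi1, hfirst, hratio, ← pow_succ', Nat.sub_add_cancel hi]
  refine (hall i).congr fun j => ?_
  rw [coeff_mk, inv_pow, div_eq_mul_inv]
end

section
/- For each fixed integer j ≥ 0, the generating function phi_j(x) = sum_{i≥0} pi_{i,j}·x^i satisfies lim_{x→(1/r_0)^−} (1 − r_0·x)^{j+1}·phi_j(x) = C^j·pi_{0,0}, where C = (q/(1−q))·((1−p)·mu_h·r_0^2 + (p·mu_h+(1−p)(1−mu_h))·r_0 + p(1−mu_h))/(p(1−mu_h) − (1−p)·mu_h·r_0^2). -/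
namespace PriorityQueue

/-- The numerical power series `∑ coeff n f * x ^ n` converges to `S`. -/
def HasValue (f : PowerSeries ℝ) (x S : ℝ) : Prop :=
  HasSum (fun n : ℕ => PowerSeries.coeff n f * x ^ n) S

theorem HasValue.mul {f g : PowerSeries ℝ} {x S T : ℝ} (hf : HasValue f x S)
    (hg : HasValue g x T) : HasValue (f * g) x (S * T) := by
  have hf' : Summable fun n => ‖PowerSeries.coeff n f * x ^ n‖ := hf.summable.norm
  have hg' : Summable fun n => ‖PowerSeries.coeff n g * x ^ n‖ := hg.summable.norm
  have h := (summable_norm_sum_mul_antidiagonal_of_summable_norm hf' hg').of_norm.hasSum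
  rw [← tsum_mul_tsum_eq_tsum_sum_antidiagonal_of_summable_norm hf' hg', hf.tsum_eq,
    hg.tsum_eq] at h
  have key : (fun n : ℕ => PowerSeries.coeff n (f * g) * x ^ n) = fun n : ℕ =>
      ∑ kl ∈ Finset.HasAntidiagonal.antidiagonal n, PowerSeries.coeff kl.1 f * x ^ kl.1 *
        (PowerSeries.coeff kl.2 g * x ^ kl.2) := by
    funext n
    rw [PowerSeries.coeff_mul, Finset.sum_mul]
    refine Finset.sum_congr rfl fun kl hkl => ?_
    rw [← Finset.HasAntidiagonal.mem_antidiagonal.mp hkl, pow_add]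
    ring
  unfold HasValue
  rw [key]
  exact h

theorem hasValue_coe (P : Polynomial ℝ) (x : ℝ) :
    HasValue (P : PowerSeries ℝ) x (P.eval x) := by
  unfold HasValue
  simp only [Polynomial.coeff_coe]
  rw [Polynomial.eval_eq_sum_range]
  refine hasSum_sum_of_ne_finset_zero fun n hn => ?_
  rw [Polynomial.coeff_eq_zero_of_natDegree_lt (by simpa using hn), zero_mul]

theorem HasValue.pow {f : PowerSeries ℝ} {x S : ℝ} (hf : HasValue f x S) (k : ℕ) :
    HasValue (f ^ k) x (S ^ k) := by
  induction k with
  | zero => simpa using hasValue_coe 1 x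
  | succ k ih => simpa only [pow_succ] using ih.mul hf

theorem hasValue_geometric {r x : ℝ} (h : |r * x| < 1) :
    HasValue (PowerSeries.mk fun n => r ^ n) x (1 - r * x)⁻¹ := by
  unfold HasValue
  simpa only [PowerSeries.coeff_mk, mul_pow] using hasSum_geometric_of_abs_lt_one h

/-- The linear polynomial `1 - r X`. -/
noncomputable def oneSubMulX (r : ℝ) : Polynomial ℝ := 1 - Polynomial.C r * Polynomial.X

@[simp]
theorem eval_oneSubMulX (r x : ℝ) : (oneSubMulX r).eval x = 1 - r * x := by
  simp [oneSubMulX]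

theorem oneSubMulX_mul_geometric (r : ℝ) :
    (oneSubMulX r : PowerSeries ℝ) * (PowerSeries.mk fun n => r ^ n) = 1 := by
  ext n
  cases n with
  | zero => simp [oneSubMulX, sub_mul, mul_assoc]
  | succ n => simp [oneSubMulX, sub_mul, mul_assoc, PowerSeries.coeff_succ_X_mul, pow_succ',
      PowerSeries.coeff_one]

/-- If `(1 - r X) ^ k * f` is a polynomial then `f` converges inside the disc of radius `1 / r`. -/
theorem hasValue_of_oneSubMulX_pow_mul_eq {f : PowerSeries ℝ} {N : Polynomial ℝ} {r x : ℝ} {k : ℕ}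
    (h : (oneSubMulX r : PowerSeries ℝ) ^ k * f = N) (hx : |r * x| < 1) :
    HasValue f x (N.eval x * ((1 - r * x)⁻¹) ^ k) := by
  have hf : f = (N : PowerSeries ℝ) * (PowerSeries.mk fun n => r ^ n) ^ k := by
    rw [← h, mul_right_comm, ← mul_pow, oneSubMulX_mul_geometric, one_pow, one_mul]
  rw [hf]
  exact (hasValue_coe N x).mul ((hasValue_geometric hx).pow k)

/-- A polynomial multiple of a series convergent at `1 / R` has no pole there. -/
theorem exists_eq_coe_of_oneSubMulX_mul {f : PowerSeries ℝ} {M : Polynomial ℝ} {R S : ℝ}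
    (hR : R ≠ 0) (hf : HasValue f R⁻¹ S) (h : (oneSubMulX R : PowerSeries ℝ) * f = M) :
    ∃ N : Polynomial ℝ, f = N ∧ oneSubMulX R * N = M := by
  have hM : M.eval R⁻¹ = 0 := by
    have h1 := (hasValue_coe (oneSubMulX R) R⁻¹).mul hf
    rw [h] at h1
    rw [HasSum.unique (hasValue_coe M R⁻¹) h1]
    simp [hR]
  obtain ⟨N, hN⟩ := Polynomial.dvd_iff_isRoot.mpr hM
  have hfac : Polynomial.X - Polynomial.C R⁻¹ = oneSubMulX R * Polynomial.C (-R⁻¹) := by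
    have : (Polynomial.C R * Polynomial.C R⁻¹ : Polynomial ℝ) = 1 := by
      rw [← Polynomial.C_mul, mul_inv_cancel₀ hR, Polynomial.C_1]
    rw [oneSubMulX, Polynomial.C_neg]
    linear_combination (-Polynomial.X) * this
  refine ⟨Polynomial.C (-R⁻¹) * N, ?_, by rw [hN, hfac, mul_assoc]⟩
  have h2 : (oneSubMulX R : PowerSeries ℝ) * f =
      (oneSubMulX R : PowerSeries ℝ) * ((Polynomial.C (-R⁻¹) * N : Polynomial ℝ) : PowerSeries ℝ) := by
    rw [h, hN, hfac, mul_assoc, Polynomial.coe_mul]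
  exact (IsUnit.of_mul_eq_one _ (oneSubMulX_mul_geometric R)).mul_left_cancel h2

theorem eq_coe_of_coeff_add_two_eq_zero {F : PowerSeries ℝ}
    (h : ∀ n, PowerSeries.coeff (n + 2) F = 0) :
    F = ((Polynomial.C (PowerSeries.coeff 0 F) +
      Polynomial.C (PowerSeries.coeff 1 F) * Polynomial.X : Polynomial ℝ) : PowerSeries ℝ) := by
  ext n
  match n with
  | 0 => simp
  | 1 => simp
  | n + 2 => simp [h]

/-- The quadratic polynomial `a X ^ 2 + b X + c`. -/
noncomputable def quadratic (a b c : ℝ) : Polynomial ℝ :=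
  Polynomial.C a * Polynomial.X ^ 2 + Polynomial.C b * Polynomial.X + Polynomial.C c

theorem coeff_quadratic_mul (a b c : ℝ) (f : PowerSeries ℝ) (n : ℕ) :
    PowerSeries.coeff (n + 2) ((quadratic a b c : PowerSeries ℝ) * f) =
      a * PowerSeries.coeff n f + b * PowerSeries.coeff (n + 1) f +
        c * PowerSeries.coeff (n + 2) f := by
  simp [quadratic, add_mul, mul_assoc, pow_two, PowerSeries.coeff_succ_X_mul]

theorem coeff_zero_quadratic_mul (a b c : ℝ) (f : PowerSeries ℝ) :
    PowerSeries.coeff 0 ((quadratic a b c : PowerSeries ℝ) * f) = c * PowerSeries.coeff 0 f := by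
  simp [quadratic]

theorem eval_quadratic (a b c x : ℝ) : (quadratic a b c).eval x = a * x ^ 2 + b * x + c := by
  simp [quadratic]

theorem quadratic_eq_mul {a b c r R : ℝ} (h1 : c * (r * R) = a) (h2 : c * (r + R) = -b) :
    quadratic a b c = Polynomial.C c * (oneSubMulX R * oneSubMulX r) := by
  obtain rfl : b = -(c * (r + R)) := by linarith
  subst h1
  simp only [quadratic, oneSubMulX, Polynomial.C_mul, Polynomial.C_neg, Polynomial.C_add]
  ring

/-- Roots of the kernel: `r = 1 / x₁` and `R = a x₁ / b` solve
`s b t ^ 2 - (1 - s c) t + s a = 0` and are separated by `1`. -/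
theorem kernel_roots {a b s c q D x r : ℝ} (ha : 0 < a) (hb : 0 < b) (hs : 0 < s) (hq : 0 < q)
    (hsq : s + q = 1) (habc : a + b + c = 1) (hD : D = (1 - s * c) ^ 2 - 4 * s ^ 2 * a * b)
    (hx : x = (1 - c * s + Real.sqrt D) / (2 * s * a)) (hr : r = 1 / x) :
    0 < r ∧ r < 1 ∧ ∃ R : ℝ, 1 < R ∧ b * (r * R) = a ∧ s * b * (r + R) = 1 - s * c := by
  have hc : 1 - s * c = q + s * (a + b) := by
    linear_combination -s * habc - hsq
  have hDlt : (s * |a - b|) ^ 2 < D := by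
    rw [mul_pow, sq_abs, hD, hc]
    nlinarith [mul_pos hq (mul_pos hs (add_pos ha hb)), sq_nonneg q]
  have hDpos : 0 ≤ D := (sq_nonneg _).trans hDlt.le
  have hw : s * |a - b| < Real.sqrt D := Real.lt_sqrt_of_sq_lt hDlt
  have hsqD := Real.sq_sqrt hDpos
  have h1 := mul_le_mul_of_nonneg_left (le_abs_self (a - b)) hs.le
  have h2 := mul_le_mul_of_nonneg_left (neg_le_abs (a - b)) hs.le
  have hx1 : 1 < x := by
    rw [hx, lt_div_iff₀ (by positivity)]
    nlinarith
  have hx0 : 0 < x := one_pos.trans hx1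
  have hxm : x * (2 * s * a) = 1 - c * s + Real.sqrt D := by
    rw [hx, div_mul_cancel₀ _ (by positivity)]
  have hR1 : 1 < a * x / b := by
    rw [lt_div_iff₀ hb]
    by_contra! hcon
    nlinarith [mul_le_mul_of_nonneg_left hcon hs.le]
  refine ⟨by rw [hr]; positivity, by rw [hr]; exact (div_lt_one hx0).2 hx1, a * x / b, hR1, ?_, ?_⟩
  · rw [hr]; field_simp
  · have hroot : s * a * x ^ 2 + s * b = (1 - s * c) * x := by
      have hw' : Real.sqrt D = x * (2 * s * a) - (1 - s * c) := by linarith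
      rw [hw', hD] at hsqD
      have : 4 * s * a * (s * a * x ^ 2 + s * b - (1 - s * c) * x) = 0 := by
        linear_combination hsqD
      rcases mul_eq_zero.mp this with h | h
      · have : 0 < 4 * s * a := by positivity
        linarith
      · linarith
    rw [hr]
    field_simp
    linear_combination hroot

theorem exists_numerator {κ r R S : ℝ} {f : PowerSeries ℝ} {M : Polynomial ℝ} {k : ℕ}
    (hκ : κ ≠ 0) (hR : R ≠ 0) (hf : HasValue f R⁻¹ S)
    (h : ((Polynomial.C κ * (oneSubMulX R * oneSubMulX r ^ k) : Polynomial ℝ) :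
      PowerSeries ℝ) * f = M) :
    ∃ N : Polynomial ℝ, (oneSubMulX r : PowerSeries ℝ) ^ k * f = N ∧
      Polynomial.C κ * (oneSubMulX R * N) = M := by
  have hκ' : (Polynomial.C κ⁻¹ * Polynomial.C κ : Polynomial ℝ) = 1 := by
    rw [← Polynomial.C_mul, inv_mul_cancel₀ hκ, Polynomial.C_1]
  have hval := ((hasValue_coe (oneSubMulX r) R⁻¹).pow k).mul hf
  have h' : (oneSubMulX R : PowerSeries ℝ) * ((oneSubMulX r : PowerSeries ℝ) ^ k * f) =
      ((Polynomial.C κ⁻¹ * M : Polynomial ℝ) : PowerSeries ℝ) := by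
    have e := congrArg (fun P : Polynomial ℝ => (P : PowerSeries ℝ)) hκ'
    simp only [Polynomial.coe_mul, Polynomial.coe_one] at e
    rw [Polynomial.coe_mul, ← h]
    simp only [Polynomial.coe_mul, Polynomial.coe_pow]
    linear_combination (-(oneSubMulX R : PowerSeries ℝ) * (oneSubMulX r : PowerSeries ℝ) ^ k * f) * e
  obtain ⟨N, hN, hM⟩ := exists_eq_coe_of_oneSubMulX_mul hR hval h'
  refine ⟨N, hN, ?_⟩
  rw [hM]
  linear_combination M * hκ'

theorem hasValue_mk_of_summable {u : ℕ → ℝ} (hu : Summable u) {y : ℝ} (hy : |y| ≤ 1) :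
    HasValue (PowerSeries.mk u) y (∑' n, u n * y ^ n) := by
  unfold HasValue
  simp only [PowerSeries.coeff_mk]
  refine (Summable.of_norm_bounded hu.abs fun n => ?_).hasSum
  rw [norm_mul, norm_pow]
  exact mul_le_of_le_one_right (norm_nonneg _) (pow_le_one₀ (norm_nonneg _) hy)

theorem exists_numerator_zero {a b s c r R : ℝ} {u : ℕ → ℝ} (hu : Summable u)
    (hb : 0 < b) (hs : 0 < s) (hr0 : 0 < r) (hr1 : r < 1) (hR : 1 < R)
    (hprod : b * (r * R) = a) (hadd : s * b * (r + R) = 1 - s * c)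
    (hrec : ∀ i, (1 - s * c) * u (i + 1) = s * a * u i + s * b * u (i + 2)) :
    ∃ N : Polynomial ℝ, (oneSubMulX r : PowerSeries ℝ) ^ 1 * PowerSeries.mk u = N ∧
      N.eval (1 / r) = u 0 := by
  have hR0 : R ≠ 0 := by positivity
  have hsb : s * b ≠ 0 := by positivity
  have hy : |R⁻¹| ≤ 1 := by
    rw [abs_of_pos (by positivity)]
    exact inv_le_one_of_one_le₀ hR.le
  have hquad : quadratic (s * a) (-(1 - s * c)) (s * b) =
      Polynomial.C (s * b) * (oneSubMulX R * oneSubMulX r ^ 1) := by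
    rw [pow_one]
    exact quadratic_eq_mul (by linear_combination s * hprod) (by linear_combination hadd)
  have hM := eq_coe_of_coeff_add_two_eq_zero
    (F := (quadratic (s * a) (-(1 - s * c)) (s * b) : PowerSeries ℝ) * PowerSeries.mk u)
    (fun n => by
      rw [coeff_quadratic_mul]
      simp only [PowerSeries.coeff_mk]
      linear_combination -hrec n)
  rw [coeff_zero_quadratic_mul, PowerSeries.coeff_mk] at hM
  generalize PowerSeries.coeff 1
    ((quadratic (s * a) (-(1 - s * c)) (s * b) : PowerSeries ℝ) * PowerSeries.mk u) = β at hM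
  rw [hquad] at hM
  obtain ⟨N, hN, hNM⟩ := exists_numerator hsb hR0 (hasValue_mk_of_summable hu hy) hM
  refine ⟨N, hN, ?_⟩
  have h1 := congrArg (Polynomial.eval R⁻¹) hNM
  have h2 := congrArg (Polynomial.eval (1 / r)) hNM
  simp only [Polynomial.eval_mul, Polynomial.eval_add, Polynomial.eval_C, Polynomial.eval_X,
    eval_oneSubMulX, mul_inv_cancel₀ hR0, sub_self, zero_mul, mul_zero] at h1 h2
  generalize N.eval (1 / r) = n at h2 ⊢
  have hβ : β = -(s * b * u 0 * R) := by
    field_simp at h1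
    linarith
  have hne : s * b * (r - R) ≠ 0 := mul_ne_zero hsb (by linarith)
  apply mul_left_cancel₀ hne
  field_simp at h2
  rw [hβ] at h2
  linear_combination h2

theorem exists_numerator_succ {a b s c q r R A : ℝ} {u v : ℕ → ℝ} {j : ℕ} (hv : Summable v)
    (hb : 0 < b) (hs : 0 < s) (hr0 : 0 < r) (hr1 : r < 1) (hR : 1 < R)
    (hprod : b * (r * R) = a) (hadd : s * b * (r + R) = 1 - s * c)
    (hrec : ∀ i, (1 - s * c) * v (i + 1) = s * a * v i + s * b * v (i + 2) +
      q * b * u (i + 2) + q * c * u (i + 1) + q * a * u i)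
    (hu : ∃ N : Polynomial ℝ, (oneSubMulX r : PowerSeries ℝ) ^ (j + 1) * PowerSeries.mk u = N ∧
      N.eval (1 / r) = A) :
    ∃ N : Polynomial ℝ, (oneSubMulX r : PowerSeries ℝ) ^ (j + 2) * PowerSeries.mk v = N ∧
      N.eval (1 / r) = q / s * (b * r ^ 2 + c * r + a) / (a - b * r ^ 2) * A := by
  obtain ⟨P, hP, hPA⟩ := hu
  have hR0 : R ≠ 0 := by positivity
  have hsb : s * b ≠ 0 := by positivity
  have hy : |R⁻¹| ≤ 1 := by
    rw [abs_of_pos (by positivity)]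
    exact inv_le_one_of_one_le₀ hR.le
  have hquad : quadratic (s * a) (-(1 - s * c)) (s * b) =
      Polynomial.C (s * b) * (oneSubMulX R * oneSubMulX r) :=
    quadratic_eq_mul (by linear_combination s * hprod) (by linear_combination hadd)
  obtain ⟨L, hL⟩ : ∃ L : Polynomial ℝ,
      (quadratic (s * a) (-(1 - s * c)) (s * b) : PowerSeries ℝ) * PowerSeries.mk v +
      (quadratic (q * a) (q * c) (q * b) : PowerSeries ℝ) * PowerSeries.mk u = L :=
    ⟨_, eq_coe_of_coeff_add_two_eq_zero fun n => by
      rw [map_add, coeff_quadratic_mul, coeff_quadratic_mul]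
      simp only [PowerSeries.coeff_mk]
      linear_combination -hrec n⟩
  rw [hquad] at hL
  have hM : ((Polynomial.C (s * b) * (oneSubMulX R * oneSubMulX r ^ (j + 2)) : Polynomial ℝ) :
      PowerSeries ℝ) * PowerSeries.mk v =
      ((oneSubMulX r ^ (j + 1) * L - quadratic (q * a) (q * c) (q * b) * P : Polynomial ℝ) :
        PowerSeries ℝ) := by
    rw [Polynomial.coe_sub, Polynomial.coe_mul _ L, Polynomial.coe_mul _ P, ← hP, ← hL]
    simp only [Polynomial.coe_mul, Polynomial.coe_pow]
    ring
  obtain ⟨N, hN, hNM⟩ := exists_numerator hsb hR0 (hasValue_mk_of_summable hv hy) hM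
  refine ⟨N, hN, ?_⟩
  have h2 := congrArg (Polynomial.eval (1 / r)) hNM
  simp only [Polynomial.eval_mul, Polynomial.eval_sub, Polynomial.eval_pow, Polynomial.eval_C,
    eval_oneSubMulX, eval_quadratic, hPA, mul_one_div_cancel hr0.ne', sub_self] at h2
  have hne : a - b * r ^ 2 ≠ 0 := by
    have : a - b * r ^ 2 = b * r * (R - r) := by linear_combination -hprod
    rw [this]
    have : 0 < R - r := by linarith
    positivity
  generalize N.eval (1 / r) = n at h2 ⊢
  rw [zero_pow (by omega)] at h2
  field_simp at h2 ⊢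
  linear_combination -h2 - s * n * hprod

end PriorityQueue

open PriorityQueue

/-- behavior of the generating function `phi_j` near its
dominant singularity `1/r_0` (approached from the left). -/
theorem phi_j_singularity
    (p q mh ml : ℝ)
    (hp : p ∈ Set.Ioo (0:ℝ) 1) (hq : q ∈ Set.Ioo (0:ℝ) 1)
    (hmh : mh ∈ Set.Ioo (0:ℝ) 1) (hml : ml ∈ Set.Ioo (0:ℝ) 1)
    (hpar : p + q + mh + ml = 1)
    (hrho : p / mh + q / ml < 1)
    (Delta : ℝ → ℝ)
    (hDelta : ∀ y, Delta y = (p*mh - (1-p)*(1-mh))^2*(q*y + 1 - q)^2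
        - 2*(p*mh + (1-p)*(1-mh))*(q*y + 1 - q) + 1)
    (x10 r0 : ℝ)
    (hx10 : x10 = (1 - (p*mh + (1-p)*(1-mh))*(1-q) + Real.sqrt (Delta 0))
        / (2*p*(1-mh)*(1-q)))
    (hr0 : r0 = 1 / x10)
    (pi : ℕ → ℕ → ℝ)
    (hnn : ∀ i j : ℕ, 0 ≤ pi i j)
    (hsum : HasSum (fun ij : ℕ × ℕ => pi ij.1 ij.2) 1)
    (hbal : BalanceEquations p q mh ml pi)
    (C : ℝ)
    (hC : C = (q/(1-q)) * ((1-p)*mh*r0^2 + (p*mh + (1-p)*(1-mh))*r0 + p*(1-mh))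
        / (p*(1-mh) - (1-p)*mh*r0^2))
    : ∀ j : ℕ,
      Filter.Tendsto (fun x : ℝ => (1 - r0*x)^(j+1) * ∑' i : ℕ, pi i j * x ^ i)
        (nhdsWithin (1/r0) (Set.Iio (1/r0)))
        (nhds (C^j * pi 0 0)) := by
  obtain ⟨hp0, hp1⟩ := hp
  obtain ⟨hq0, hq1⟩ := hq
  obtain ⟨hh0, hh1⟩ := hmh
  obtain ⟨-, hb0, -, hbij⟩ := hbal
  have ha : 0 < p * (1 - mh) := mul_pos hp0 (by linarith)
  have hb : 0 < (1 - p) * mh := mul_pos (by linarith) hh0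
  have hs : 0 < 1 - q := by linarith
  obtain ⟨hr0', hr1, R, hR, hprod, hadd⟩ := kernel_roots (D := Delta 0) (x := x10)
    (c := p * mh + (1 - p) * (1 - mh)) ha hb hs hq0 (by ring) (by ring)
    (by rw [hDelta]; ring) (by rw [hx10]; ring) hr0
  have hcol : ∀ j, Summable fun i => pi i j := fun j =>
    hsum.summable.comp_injective (i := fun i : ℕ => (i, j)) fun i i' h => (Prod.mk.inj h).1
  have hnum : ∀ j, ∃ N : Polynomial ℝ,
      (oneSubMulX r0 : PowerSeries ℝ) ^ (j + 1) * PowerSeries.mk (fun i => pi i j) = N ∧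
      N.eval (1 / r0) = C ^ j * pi 0 0 := by
    intro j
    induction j with
    | zero =>
      rw [pow_zero, one_mul]
      refine exists_numerator_zero (hcol 0) hb hs hr0' hr1 hR hprod hadd fun i => ?_
      have h := hb0 (i + 1) (by omega)
      rw [Nat.add_sub_cancel] at h
      linear_combination h
    | succ j ih =>
      have h := exists_numerator_succ (q := q) (hcol (j + 1)) hb hs hr0' hr1 hR hprod hadd
        (fun i => ?_) ih
      · rw [← hC, ← mul_assoc, ← pow_succ'] at h
        exact h
      · have h := hbij (i + 1) (j + 1) (by omega) (by omega)
        rw [Nat.add_sub_cancel, Nat.add_sub_cancel] at h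
        linear_combination h
  intro j
  obtain ⟨N, hN, hval⟩ := hnum j
  rw [← hval]
  refine (N.continuous.continuousAt.tendsto.mono_left nhdsWithin_le_nhds).congr' ?_
  filter_upwards [Ioo_mem_nhdsLT (one_div_pos.mpr hr0')] with x hx
  have hx1 : r0 * x < 1 := by
    rw [mul_comm]
    exact (lt_div_iff₀ hr0').mp hx.2
  have hsumx := hasValue_of_oneSubMulX_pow_mul_eq hN
    (by rwa [abs_of_pos (mul_pos hr0' hx.1)])
  unfold HasValue at hsumx
  simp only [PowerSeries.coeff_mk] at hsumx
  rw [hsumx.tsum_eq, mul_left_comm, ← mul_pow, mul_inv_cancel₀ (by linarith), one_pow, mul_one]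
end
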